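/- arXiv:2506.05101 — 7 statements merged into one kernel-verified Lean document; each statement's English description precedes it below -/
import Mathlib

section
/- In the noisy gradient descent stationary setting, if additionally Y − Y' has rank one (in particular when Y and Y' differ in exactly one row, as in label differential privacy), then σ_max(A Xᵀ (Y−Y')) = ‖A Xᵀ (Y−Y')‖, where A is the symmetric positive definite square root of Σ⁻¹M; hence there exists z ∈ ℝ^d such that T(V_∞ z, W_∞ z) = T(V_∞, W_∞). -/
open MeasureTheory ProbabilityTheory Matrix Set

noncomputable section

namespace Paper

instance {m n : Type*} : MeasurableSpace (Matrix m n ℝ) :=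
  inferInstanceAs (MeasurableSpace (m → n → ℝ))

instance {m n : Type*} [Fintype m] [Fintype n] : MeasureSpace (Matrix m n ℝ) :=
  inferInstanceAs (MeasureSpace (m → n → ℝ))

def tradeOff {E : Type*} [MeasurableSpace E] (P Q : Measure E) (α : ℝ) : ℝ :=
  sInf {β : ℝ | ∃ φ : E → ℝ, Measurable φ ∧ (∀ x, 0 ≤ φ x ∧ φ x ≤ 1) ∧
    (∫ x, φ x ∂P) ≤ α ∧ β = 1 - ∫ x, φ x ∂Q}

def Φ (x : ℝ) : ℝ := (gaussianReal 0 1 (Iic x)).toReal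

def Φinv : ℝ → ℝ := Function.invFun Φ

def Gtrade (μ α : ℝ) : ℝ := Φ (Φinv (1 - α) - μ)

def vnorm {k : ℕ} (x : Fin k → ℝ) : ℝ := Real.sqrt (∑ i, x i ^ 2)

def fnorm {m n : ℕ} (A : Matrix (Fin m) (Fin n) ℝ) : ℝ := Real.sqrt (∑ i, ∑ j, A i j ^ 2)

/-- Multivariate Gaussian `N(μ, S)` on `ℝ^k`, via its density w.r.t. Lebesgue measure. -/
def gaussianVec {k : ℕ} (μ : Fin k → ℝ) (S : Matrix (Fin k) (Fin k) ℝ) : Measure (Fin k → ℝ) :=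
  volume.withDensity fun x =>
    ENNReal.ofReal (((2 * Real.pi) ^ k * S.det) ^ (-(1:ℝ)/2) *
      Real.exp (-(1/2) * ((x - μ) ⬝ᵥ (S⁻¹ *ᵥ (x - μ)))))

/-- The stationary law of noisy gradient descent: the random matrix in `ℝ^{n×d}` with
independent rows whose `i`-th row has law `N((1/m) Σ⁻¹ Xᵀ Y_{·,i}, σ² M⁻¹ Σ⁻¹)`. -/
def ngdStationary {m d n : ℕ} (X : Matrix (Fin m) (Fin d) ℝ) (Y : Matrix (Fin m) (Fin n) ℝ)
    (Sig Mm : Matrix (Fin d) (Fin d) ℝ) (σ : ℝ) : Measure (Matrix (Fin n) (Fin d) ℝ) :=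
  Measure.pi fun i : Fin n =>
    gaussianVec ((1 / (m : ℝ)) • ((Sig⁻¹ * Xᵀ) *ᵥ fun k => Y k i)) (σ ^ 2 • (Mm⁻¹ * Sig⁻¹))

/-- The largest singular value of a matrix: the square root of the largest
eigenvalue of `Cᵀ C`. -/
def sigmaMax {a b : ℕ} (C : Matrix (Fin a) (Fin b) ℝ) : ℝ :=
  Real.sqrt (sSup (spectrum ℝ (Cᵀ * C)))


lemma tradeOff_map_eq {E F : Type*} [mE : MeasurableSpace E] [mF : MeasurableSpace F] (P Q : Measure E)
    [IsFiniteMeasure P] [IsFiniteMeasure Q] (f : E → F) (hf : Measurable f) (g : F → ℝ)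
    (hg : Measurable g) (hg0 : ∀ y, 0 ≤ g y)
    (hQ : Q = P.withDensity (fun x => ENNReal.ofReal (g (f x)))) (α : ℝ) :
    tradeOff (P.map f) (Q.map f) α = tradeOff P Q α := by
  have hmeas : Measurable (fun x => ENNReal.ofReal (g (f x))) := by fun_prop
  have hint : ∀ φ : E → ℝ, ∫ x, φ x ∂Q = ∫ x, φ x * g (f x) ∂P := by
    intro φ
    rw [hQ, integral_withDensity_eq_integral_toReal_smul hmeas (by simp)]
    congr 1; ext x
    rw [ENNReal.toReal_ofReal (hg0 _), smul_eq_mul, mul_comm]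
  have hgi : Integrable (fun x => g (f x)) P := by
    refine ⟨(hg.comp hf).aestronglyMeasurable, ?_⟩
    rw [hasFiniteIntegral_iff_ofReal (ae_of_all _ fun x => hg0 _)]
    have := measure_lt_top Q univ
    rwa [hQ, withDensity_apply _ MeasurableSet.univ, Measure.restrict_univ] at this
  unfold tradeOff
  congr 1
  ext β
  constructor
  · rintro ⟨φ, hφ, hb, h1, h2⟩
    refine ⟨φ ∘ f, hφ.comp hf, fun x => hb _, ?_, ?_⟩
    · rw [integral_map hf.aemeasurable hφ.aestronglyMeasurable] at h1
      exact h1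
    · rw [integral_map hf.aemeasurable hφ.aestronglyMeasurable] at h2
      exact h2
  · rintro ⟨φ, hφ, hb, h1, h2⟩
    have hφi : Integrable φ P := by
      refine Integrable.of_bound hφ.aestronglyMeasurable 1 (ae_of_all _ fun x => ?_)
      rw [Real.norm_eq_abs, abs_le]; constructor <;> linarith [(hb x).1, (hb x).2]
    have hφg : Integrable (fun x => φ x * g (f x)) P := by
      refine hgi.bdd_mul (c := 1) hφ.aestronglyMeasurable (ae_of_all _ fun x => ?_)
      rw [Real.norm_eq_abs, abs_le]; constructor <;> linarith [(hb x).1, (hb x).2]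
    have hle : mF.comap f ≤ mE := hf.comap_le
    obtain ⟨ψ, hψ, hψe⟩ := (stronglyMeasurable_condExp (f := φ) (μ := P) (m := mF.comap f)).exists_eq_measurable_comp
    have hge : StronglyMeasurable[mF.comap f] (fun x => g (f x)) :=
      (hg.comp (comap_measurable f)).stronglyMeasurable
    have hpull := condExp_mul_of_stronglyMeasurable_right (μ := P) (m := mF.comap f) (f := φ) hge hφg hφi
    have hlo : 0 ≤ᵐ[P] P[φ | mF.comap f] := condExp_nonneg (ae_of_all _ fun x => (hb x).1)
    have hhi : P[φ | mF.comap f] ≤ᵐ[P] P[(fun _ => (1:ℝ)) | mF.comap f] :=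
      condExp_mono hφi (integrable_const _) (ae_of_all _ fun x => (hb x).2)
    rw [condExp_const hle] at hhi
    set χ : F → ℝ := fun y => max 0 (min 1 (ψ y)) with hχ
    have hχm : Measurable χ := by
      have := hψ.measurable
      fun_prop
    have hχe : ∀ᵐ x ∂P, χ (f x) = (P[φ | mF.comap f]) x := by
      filter_upwards [hlo, hhi] with x h1 h2
      have : ψ (f x) = (P[φ | mF.comap f]) x := by rw [hψe]; rfl
      simp only [hχ, this]
      rw [min_eq_right h2]; exact max_eq_right h1
    refine ⟨χ, hχm, fun y => ⟨le_max_left _ _, max_le zero_le_one (min_le_left _ _)⟩, ?_, ?_⟩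
    · rw [integral_map hf.aemeasurable hχm.aestronglyMeasurable, integral_congr_ae hχe,
        integral_condExp hle]
      exact h1
    · rw [integral_map hf.aemeasurable hχm.aestronglyMeasurable, h2, hint, hint]
      congr 1
      rw [← integral_condExp hle]
      refine integral_congr_ae ?_
      filter_upwards [hpull, hχe] with x h1 h2
      rw [h2]; exact h1

lemma pi_withDensity_eq {ι : Type*} [Fintype ι] {E : ι → Type*} [∀ i, MeasurableSpace (E i)]
    (P Q : ∀ i, Measure (E i)) [∀ i, IsFiniteMeasure (P i)] [∀ i, IsFiniteMeasure (Q i)]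
    (g : ∀ i, E i → ℝ) (hg : ∀ i, Measurable (g i)) (hg0 : ∀ i y, 0 ≤ g i y)
    (hQ : ∀ i, Q i = (P i).withDensity (fun x => ENNReal.ofReal (g i x))) :
    Measure.pi Q = (Measure.pi P).withDensity (fun x => ENNReal.ofReal (∏ i, g i (x i))) := by
  have hgi : ∀ i, Integrable (g i) (P i) := by
    intro i
    refine ⟨(hg i).aestronglyMeasurable, ?_⟩
    rw [hasFiniteIntegral_iff_ofReal (ae_of_all _ fun x => hg0 _ _)]
    have := measure_lt_top (Q i) univ
    rwa [hQ, withDensity_apply _ MeasurableSet.univ, Measure.restrict_univ] at this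
  refine Measure.pi_eq fun s hs => ?_
  rw [withDensity_apply _ (MeasurableSet.univ_pi hs), Measure.restrict_pi_pi,
    ← ofReal_integral_eq_lintegral_ofReal, integral_fintype_prod_eq_prod,
    ENNReal.ofReal_prod_of_nonneg]
  · refine Finset.prod_congr rfl fun i _ => ?_
    rw [hQ, withDensity_apply _ (hs i), ← ofReal_integral_eq_lintegral_ofReal]
    · exact (hgi i).restrict
    · exact ae_of_all _ fun x => hg0 _ _
  · exact fun i _ => integral_nonneg fun x => hg0 _ _
  · exact Integrable.fintype_prod_dep fun i => (hgi i).restrict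
  · exact ae_of_all _ fun x => Finset.prod_nonneg fun i _ => hg0 _ _

lemma sum_sq_mulVec_le {k l : ℕ} (N : Matrix (Fin k) (Fin l) ℝ) (y : Fin l → ℝ) :
    ∑ i, (N *ᵥ y) i ^ 2 ≤ (∑ i, ∑ j, N i j ^ 2) * ∑ j, y j ^ 2 := by
  rw [Finset.sum_mul]
  refine Finset.sum_le_sum fun i _ => ?_
  exact Finset.sum_mul_sq_le_sq_mul_sq Finset.univ (fun j => N i j) y

lemma quad_eq {k : ℕ} (B : Matrix (Fin k) (Fin k) ℝ) (x : Fin k → ℝ) :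
    x ⬝ᵥ ((Bᵀ * B) *ᵥ x) = ∑ i, (B *ᵥ x) i ^ 2 := by
  rw [← mulVec_mulVec, dotProduct_mulVec, vecMul_transpose]
  simp [dotProduct, sq]

lemma gaussianVec_finite {k : ℕ} (μ : Fin k → ℝ) (S B : Matrix (Fin k) (Fin k) ℝ)
    (hB : IsUnit B.det) (hS : S⁻¹ = Bᵀ * B) : IsFiniteMeasure (gaussianVec μ S) := by
  unfold gaussianVec
  refine isFiniteMeasure_withDensity_ofReal ?_
  refine HasFiniteIntegral.const_mul ?_ _
  set C : ℝ := (∑ i, ∑ j, B⁻¹ i j ^ 2) + 1 with hC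
  have hC0 : 0 < C := by positivity
  have h1 : Integrable (fun x : Fin k → ℝ => ∏ i, Real.exp (-(1/(2*C)) * x i ^ 2)) volume :=
    Integrable.fintype_prod (f := fun _ (t : ℝ) => Real.exp (-(1/(2*C)) * t ^ 2))
      fun i => integrable_exp_neg_mul_sq (by positivity)
  have h2 := h1.comp_sub_right μ
  refine (h2.mono' ?_ ?_).2
  · refine Continuous.aestronglyMeasurable ?_
    fun_prop
  · refine ae_of_all _ fun x => ?_
    rw [Real.norm_eq_abs, abs_of_pos (Real.exp_pos _), ← Real.exp_sum, Real.exp_le_exp, hS, quad_eq,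
      ← Finset.mul_sum]
    set y := x - μ with hy
    have h3 : ∑ i, y i ^ 2 ≤ C * ∑ i, (B *ᵥ y) i ^ 2 := by
      have := sum_sq_mulVec_le B⁻¹ (B *ᵥ y)
      rw [mulVec_mulVec, nonsing_inv_mul _ hB, one_mulVec] at this
      have h0 : 0 ≤ ∑ i, (B *ᵥ y) i ^ 2 := by positivity
      rw [hC]; linarith
    have h4 : (1/(2*C)) * ∑ i, y i ^ 2 ≤ (1/(2*C)) * (C * ∑ i, (B *ᵥ y) i ^ 2) :=
      mul_le_mul_of_nonneg_left h3 (by positivity)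
    have h5 : (1/(2*C)) * (C * ∑ i, (B *ᵥ y) i ^ 2) = 1/2 * ∑ i, (B *ᵥ y) i ^ 2 := by
      field_simp
    linarith

lemma gaussianVec_ratio {k : ℕ} (a a' v : Fin k → ℝ) (t : ℝ) (S : Matrix (Fin k) (Fin k) ℝ)
    (hS : (S⁻¹)ᵀ = S⁻¹) (h : a = a' + t • v) :
    gaussianVec a' S = (gaussianVec a S).withDensity (fun x => ENNReal.ofReal
      (Real.exp (-(t * (x ⬝ᵥ (S⁻¹ *ᵥ v) - a ⬝ᵥ (S⁻¹ *ᵥ v))) - t ^ 2 / 2 * (v ⬝ᵥ (S⁻¹ *ᵥ v))))) := by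
  unfold gaussianVec
  rw [← withDensity_mul]
  · congr 1
    ext x
    rw [Pi.mul_apply, ← ENNReal.ofReal_mul' (Real.exp_nonneg _), mul_assoc, ← Real.exp_add]
    congr 3
    have e : x - a' = (x - a) + t • v := by rw [h]; abel
    have sy : v ⬝ᵥ (S⁻¹ *ᵥ (x - a)) = (x - a) ⬝ᵥ (S⁻¹ *ᵥ v) := by
      conv_lhs => rw [← hS]
      rw [mulVec_transpose, dotProduct_comm, dotProduct_mulVec]
    rw [e, mulVec_add, mulVec_smul, add_dotProduct, dotProduct_add, dotProduct_add,
      smul_dotProduct, smul_dotProduct, dotProduct_smul, dotProduct_smul, sy, sub_dotProduct x a (S⁻¹ *ᵥ v)]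
    simp only [smul_eq_mul]
    ring
  · refine (Continuous.measurable ?_).ennreal_ofReal
    fun_prop
  · refine (Continuous.measurable ?_).ennreal_ofReal
    fun_prop

lemma rank_one_factor {m n : ℕ} (D : Matrix (Fin m) (Fin n) ℝ) (h : D.rank = 1) :
    ∃ (u : Fin m → ℝ) (w : Fin n → ℝ), w ≠ 0 ∧ D = vecMulVec u w := by
  rw [Matrix.rank] at h
  obtain ⟨u, hu, hc⟩ := finrank_eq_one_iff'.1 h
  choose c hc using hc
  have hmem : ∀ j, D *ᵥ Pi.single j 1 ∈ D.mulVecLin.range := fun j => ⟨_, rfl⟩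
  have key : ∀ i j, D i j = c ⟨_, hmem j⟩ * (u : Fin m → ℝ) i := by
    intro i j
    have h1 := congrArg (fun z : D.mulVecLin.range => (z : Fin m → ℝ) i) (hc ⟨_, hmem j⟩)
    have h2 : (D *ᵥ Pi.single j 1) i = D i j := by simp
    rw [← h2]
    exact h1.symm
  refine ⟨u, fun j => c ⟨_, hmem j⟩, ?_, ?_⟩
  · intro hw
    have hD : D = 0 := by
      ext i j
      have h2 : c ⟨_, hmem j⟩ = 0 := congrFun hw j
      rw [key, h2, zero_mul]
      rfl
    have h3 : D.rank = 0 := by rw [hD, rank_zero]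
    rw [Matrix.rank] at h3
    omega
  · ext i j
    rw [key, vecMulVec_apply, mul_comm]

lemma sigmaMax_rank_one {a b : ℕ} (p : Fin a → ℝ) (w : Fin b → ℝ) (hw : w ≠ 0) :
    sigmaMax (vecMulVec p w) = fnorm (vecMulVec p w) := by
  unfold sigmaMax fnorm
  have hs : ∑ i, ∑ j, (vecMulVec p w) i j ^ 2 = (p ⬝ᵥ p) * (w ⬝ᵥ w) := by
    simp only [vecMulVec_apply, dotProduct, Finset.sum_mul_sum]
    refine Finset.sum_congr rfl fun i _ => Finset.sum_congr rfl fun j _ => by ring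
  rw [hs]
  congr 1
  have hC : ∀ x : Fin b → ℝ, ((vecMulVec p w)ᵀ * vecMulVec p w) *ᵥ x
      = ((p ⬝ᵥ p) * (w ⬝ᵥ x)) • w := by
    intro x
    rw [transpose_vecMulVec, vecMulVec_mul_vecMulVec]
    ext i
    rw [Pi.smul_apply, smul_eq_mul, mulVec, dotProduct, dotProduct_comm w x]
    simp only [dotProduct.eq_1 x w, Finset.mul_sum, Finset.sum_mul, vecMulVec_apply, 
      Pi.smul_apply, smul_eq_mul]
    refine Finset.sum_congr rfl fun j _ => ?_
    ring
  apply IsGreatest.csSup_eq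
  constructor
  · rw [← Matrix.spectrum_toLin', ← Module.End.hasEigenvalue_iff_mem_spectrum]
    refine Module.End.hasEigenvalue_of_hasEigenvector (x := w) ?_
    rw [Module.End.hasEigenvector_iff, Module.End.mem_eigenspace_iff]
    refine ⟨?_, hw⟩
    rw [toLin'_apply, hC]
  · intro μ hμ
    rw [← Matrix.spectrum_toLin', ← Module.End.hasEigenvalue_iff_mem_spectrum] at hμ
    obtain ⟨x, hx⟩ := hμ.exists_hasEigenvector
    rw [Module.End.hasEigenvector_iff, Module.End.mem_eigenspace_iff, toLin'_apply, hC] at hx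
    obtain ⟨h1, h2⟩ := hx
    have h3 := congrArg (fun z => w ⬝ᵥ z) h1
    simp only [dotProduct_smul, smul_eq_mul] at h3
    by_cases h0 : w ⬝ᵥ x = 0
    · rw [h0, mul_zero, zero_smul] at h1
      have : μ = 0 := by
        rcases smul_eq_zero.1 h1.symm with h | h
        · exact h
        · exact absurd h h2
      rw [this]
      have h5 : 0 ≤ p ⬝ᵥ p := by simpa using dotProduct_self_star_nonneg p
      have h6 : 0 ≤ w ⬝ᵥ w := by simpa using dotProduct_self_star_nonneg w
      positivity
    · have : μ = (p ⬝ᵥ p) * (w ⬝ᵥ w) := by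
        apply mul_right_cancel₀ h0
        linarith
      exact this.le

theorem statement3 (m d n : ℕ) (hm : 1 ≤ m) (hd : 1 ≤ d) (hn : 1 ≤ n)
    (X : Matrix (Fin m) (Fin d) ℝ) (Y Y' : Matrix (Fin m) (Fin n) ℝ) (hYY' : Y ≠ Y')
    (lam η σ : ℝ) (hlam : 0 < lam) (hη : 0 < η) (hσ : 0 < σ)
    (Sig Mm : Matrix (Fin d) (Fin d) ℝ)
    (hSig : Sig = (1 / (m : ℝ)) • (Xᵀ * X) + lam • (1 : Matrix (Fin d) (Fin d) ℝ))
    (hM : Mm = 1 - (2 * η) • Sig) (hMpd : Mm.PosDef)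
    (A : Matrix (Fin d) (Fin d) ℝ)
    (hApd : A.PosDef) (hA : A * A = Sig⁻¹ * Mm)
    -- Y − Y' has rank one (e.g. Y and Y' differ in exactly one row)
    (hrank : (Y - Y').rank = 1) :
    sigmaMax (A * Xᵀ * (Y - Y')) = fnorm (A * Xᵀ * (Y - Y')) ∧
    ∃ z : Fin d → ℝ, ∀ α ∈ Icc (0:ℝ) 1,
      tradeOff
        (Measure.map (fun V : Matrix (Fin n) (Fin d) ℝ => V *ᵥ z) (ngdStationary X Y Sig Mm σ))
        (Measure.map (fun V : Matrix (Fin n) (Fin d) ℝ => V *ᵥ z) (ngdStationary X Y' Sig Mm σ))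
        α =
      tradeOff (ngdStationary X Y Sig Mm σ) (ngdStationary X Y' Sig Mm σ) α := by
  have hm0 : (0:ℝ) < 1 / (m : ℝ) := by
    have : (0:ℝ) < m := by exact_mod_cast hm
    positivity
  have hSpd : Sig.PosDef := by
    rw [hSig]
    refine Matrix.PosDef.posSemidef_add ?_ ?_
    · have := posSemidef_conjTranspose_mul_self X
      rw [conjTranspose_eq_transpose_of_trivial] at this
      exact this.smul hm0.le
    · exact PosDef.one.smul hlam
  have hSu : IsUnit Sig.det := (Matrix.isUnit_iff_isUnit_det _).1 hSpd.isUnit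
  have hMu : IsUnit Mm.det := (Matrix.isUnit_iff_isUnit_det _).1 hMpd.isUnit
  have hAu : IsUnit A.det := (Matrix.isUnit_iff_isUnit_det _).1 hApd.isUnit
  have hSt : Sigᵀ = Sig := by
    have := hSpd.isHermitian.eq
    rwa [conjTranspose_eq_transpose_of_trivial] at this
  have hAt : Aᵀ = A := by
    have := hApd.isHermitian.eq
    rwa [conjTranspose_eq_transpose_of_trivial] at this
  have hcomm : Mm * Sig = Sig * Mm := by
    rw [hM]; simp [sub_mul, mul_sub]
  set S : Matrix (Fin d) (Fin d) ℝ := σ ^ 2 • (Mm⁻¹ * Sig⁻¹) with hSdef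
  set B : Matrix (Fin d) (Fin d) ℝ := σ⁻¹ • (A * Sig) with hBdef
  have hBu : IsUnit B.det := by
    rw [hBdef, det_smul, det_mul]
    exact ((isUnit_iff_ne_zero.2 (by positivity)).mul (hAu.mul hSu))
  have hBB : Bᵀ * B = (σ⁻¹ * σ⁻¹) • (Sig * Mm) := by
    rw [hBdef, transpose_smul, transpose_mul, hSt, hAt, smul_mul_smul_comm]
    congr 1
    calc Sig * A * (A * Sig) = Sig * (A * A) * Sig := by simp only [mul_assoc]
      _ = Sig * Sig⁻¹ * (Mm * Sig) := by rw [hA]; simp only [mul_assoc]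
      _ = Sig * Mm := by rw [mul_nonsing_inv _ hSu, one_mul, hcomm]
  have hSinv : S⁻¹ = Bᵀ * B := by
    apply inv_eq_right_inv
    rw [hBB, hSdef, smul_mul_smul_comm]
    have e1 : Mm⁻¹ * Sig⁻¹ * (Sig * Mm) = 1 := by
      calc Mm⁻¹ * Sig⁻¹ * (Sig * Mm) = Mm⁻¹ * (Sig⁻¹ * Sig) * Mm := by simp only [mul_assoc]
        _ = 1 := by rw [nonsing_inv_mul _ hSu, mul_one, nonsing_inv_mul _ hMu]
    rw [e1]
    have : σ ^ 2 * (σ⁻¹ * σ⁻¹) = 1 := by field_simp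
    rw [this, one_smul]
  have hSsym : (S⁻¹)ᵀ = S⁻¹ := by
    rw [hSinv, transpose_mul, transpose_transpose]
  obtain ⟨u, w, hw, hD⟩ := rank_one_factor _ hrank
  refine ⟨?_, ?_⟩
  · rw [hD, mul_vecMulVec]
    exact sigmaMax_rank_one _ _ hw
  set v : Fin d → ℝ := (1 / (m : ℝ)) • ((Sig⁻¹ * Xᵀ) *ᵥ u) with hv
  set a : Fin n → Fin d → ℝ := fun i => (1 / (m : ℝ)) • ((Sig⁻¹ * Xᵀ) *ᵥ fun k => Y k i) with ha
  set a' : Fin n → Fin d → ℝ := fun i => (1 / (m : ℝ)) • ((Sig⁻¹ * Xᵀ) *ᵥ fun k => Y' k i) with ha'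
  have haa : ∀ i, a i = a' i + w i • v := by
    intro i
    have e : (fun k => Y k i) = (fun k => Y' k i) + w i • u := by
      ext k
      have := congrFun (congrFun hD k) i
      simp only [Matrix.sub_apply, vecMulVec_apply] at this
      simp only [Pi.add_apply, Pi.smul_apply, smul_eq_mul]
      linarith
    simp only [ha, ha', hv]
    rw [e, mulVec_add, mulVec_smul, smul_add, smul_comm (w i)]
  set z := S⁻¹ *ᵥ v with hz
  have hfin : ∀ μ, IsFiniteMeasure (gaussianVec μ S) := fun μ => gaussianVec_finite μ S B hBu hSinv
  set g : Fin n → (Fin d → ℝ) → ℝ := fun i x =>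
    Real.exp (-(w i * (x ⬝ᵥ z - a i ⬝ᵥ z)) - w i ^ 2 / 2 * (v ⬝ᵥ z)) with hg
  have hgm : ∀ i, Measurable (g i) := by
    intro i
    refine Continuous.measurable ?_
    simp only [hg]
    fun_prop
  have key := pi_withDensity_eq (fun i => gaussianVec (a i) S) (fun i => gaussianVec (a' i) S) g
    hgm (fun i y => Real.exp_nonneg _)
    (fun i => gaussianVec_ratio (a i) (a' i) v (w i) S hSsym (haa i))
  refine ⟨z, fun α _ => ?_⟩
  have hP0 : IsFiniteMeasure (Measure.pi fun i => gaussianVec (a i) S) := inferInstance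
  have hQ0 : IsFiniteMeasure (Measure.pi fun i => gaussianVec (a' i) S) := inferInstance
  have hP : IsFiniteMeasure (ngdStationary X Y Sig Mm σ) :=
    hP0
  have hQ : IsFiniteMeasure (ngdStationary X Y' Sig Mm σ) :=
    hQ0
  refine tradeOff_map_eq (ngdStationary X Y Sig Mm σ) (ngdStationary X Y' Sig Mm σ)
    (fun V : Matrix (Fin n) (Fin d) ℝ => V *ᵥ z) ?_
    (fun y => ∏ i, Real.exp (-(w i * (y i - a i ⬝ᵥ z)) - w i ^ 2 / 2 * (v ⬝ᵥ z))) ?_ ?_ key α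
  · refine measurable_pi_lambda _ fun i => ?_
    have : Continuous (fun V : Fin n → Fin d → ℝ => V i ⬝ᵥ z) := by fun_prop
    exact this.measurable
  · refine Continuous.measurable ?_
    fun_prop
  · exact fun y => Finset.prod_nonneg fun i _ => Real.exp_nonneg _

end Paper
end
end

section
/- Let X ∈ ℝ^{m×d}, Y ∈ ℝ^{m×n}, λ, η, σ > 0, Σ = (1/m)XᵀX + λI_d, M = I_d − 2ηΣ, and B = (2η/m)YᵀX ∈ ℝ^{n×d}; assume η λ_max(Σ) < 1 (so that I_d − M² is invertible; I_d − M = 2ηΣ is always invertible). Let V₀ ∈ ℝ^{n×d} be a standard Gaussian matrix, let {N_t}_{t≥1} be i.i.d. standard Gaussian n×d matrices independent of V₀, and define the noisy gradient descent iterates V_{t+1} = V_t M + B + √(2η) σ N_{t+1}. Then for every t ≥ 1 the rows of V_t are independent Gaussian vectors, and the i-th row of V_t has mean B_i (I−M)⁻¹ (I − M^t) (where B_i is the i-th row of B) and covariance matrix M^{2t} + 2η σ² (I − M²)⁻¹ (I − M^{2t}). -/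
open MeasureTheory ProbabilityTheory Matrix Set

noncomputable section

namespace Paper

def stdGaussianMatrix (m n : ℕ) : Measure (Matrix (Fin m) (Fin n) ℝ) :=
  (Measure.pi fun _ : Fin m => Measure.pi fun _ : Fin n => gaussianReal 0 1)

lemma lintegral_pi_prod {k : ℕ} (ν : Fin k → Measure ℝ) [∀ i, SigmaFinite (ν i)]
    (f : ℝ → ENNReal) (hf : Measurable f) :
    ∫⁻ x, ∏ i, f (x i) ∂(Measure.pi ν) = ∏ i, ∫⁻ x, f x ∂(ν i) := by
  induction k with
  | zero => simp
  | succ k ih =>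
    have h := (measurePreserving_piFinSuccAbove ν 0)
    have h2 := h.lintegral_comp_emb (MeasurableEquiv.measurableEmbedding _)
      (fun p : ℝ × (Fin k → ℝ) => f p.1 * ∏ i, f (p.2 i))
    have h3 : ∫⁻ p : ℝ × (Fin k → ℝ), f p.1 * ∏ i, f (p.2 i)
        ∂((ν 0).prod (Measure.pi fun j : Fin k => ν (Fin.succ j)))
        = (∫⁻ x, f x ∂(ν 0)) * ∫⁻ x, ∏ i, f (x i) ∂(Measure.pi fun j : Fin k => ν (Fin.succ j)) := by
      apply lintegral_prod_mul (f := f) (g := fun x : Fin k → ℝ => ∏ i, f (x i)) hf.aemeasurable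
      exact (Finset.measurable_prod _ (fun i _ => hf.comp (measurable_pi_apply i))).aemeasurable
    rw [ih (fun j => ν (Fin.succ j))] at h3
    rw [Fin.prod_univ_succ, ← h3]
    simp only [Fin.prod_univ_succ]
    exact h2

lemma pi_gaussian_density (k : ℕ) :
    (Measure.pi fun _ : Fin k => gaussianReal 0 1) =
      volume.withDensity (fun x => ∏ i, gaussianPDF 0 1 (x i)) := by
  apply Measure.pi_eq
  intro s hs
  rw [withDensity_apply _ (MeasurableSet.univ_pi hs), volume_pi, Measure.restrict_pi_pi,
    lintegral_pi_prod _ _ (measurable_gaussianPDF 0 1)]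
  refine Finset.prod_congr rfl fun i _ => ?_
  rw [gaussianReal_of_var_ne_zero _ one_ne_zero, withDensity_apply _ (hs i)]

lemma map_affine {k : ℕ} (A : Matrix (Fin k) (Fin k) ℝ) (hA : A.det ≠ 0) (μ : Fin k → ℝ)
    (g h : (Fin k → ℝ) → ENNReal) (hh : Measurable h)
    (hgh : ∀ x, g x = ENNReal.ofReal |A.det| * h (μ + A *ᵥ x)) :
    Measure.map (fun x => μ + A *ᵥ x) (volume.withDensity g) = volume.withDensity h := by
  have hT : Measurable (fun x : Fin k → ℝ => μ + A *ᵥ x) := by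
    apply Continuous.measurable; fun_prop
  have hmap : Measure.map (fun x => μ + A *ᵥ x) (volume : Measure (Fin k → ℝ)) =
      ENNReal.ofReal (abs (A.det)⁻¹) • volume := by
    rw [show (fun x => μ + A *ᵥ x) = (fun x => μ + x) ∘ (toLin' A) from rfl,
      ← Measure.map_map (by fun_prop) (by apply Continuous.measurable; exact LinearMap.continuous_of_finiteDimensional _),
      Real.map_matrix_volume_pi_eq_smul_volume_pi hA, Measure.map_smul, map_add_left_eq_self]
  ext s hs
  rw [Measure.map_apply hT hs, withDensity_apply _ (hT hs), withDensity_apply _ hs]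
  simp_rw [hgh]
  rw [lintegral_const_mul (f := fun x => h (μ + A *ᵥ x)) _ (hh.comp hT)]
  have : ∫⁻ x in (fun x => μ + A *ᵥ x) ⁻¹' s, h (μ + A *ᵥ x) = 
      ∫⁻ x in s, h x ∂(Measure.map (fun x => μ + A *ᵥ x) volume) := by
    rw [setLIntegral_map hs hh hT]
  rw [this, hmap, Measure.restrict_smul, lintegral_smul_measure, smul_eq_mul, ← mul_assoc,
    ← ENNReal.ofReal_mul (abs_nonneg _), ← abs_mul, mul_inv_cancel₀ hA]
  simp

lemma prod_pdf {k : ℕ} (x : Fin k → ℝ) : ∏ i, gaussianPDF 0 1 (x i) =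
    ENNReal.ofReal (((2 * Real.pi) ^ k) ^ (-(1:ℝ)/2) * Real.exp (-(1/2) * (x ⬝ᵥ x))) := by
  simp only [gaussianPDF]
  rw [← ENNReal.ofReal_prod_of_nonneg (fun i _ => gaussianPDFReal_nonneg _ _ _)]
  congr 1
  simp only [gaussianPDFReal]
  rw [Finset.prod_mul_distrib, ← Real.exp_sum]
  congr 1
  · simp only [Finset.prod_const, Finset.card_univ, Fintype.card_fin]
    have h0 : (0:ℝ) ≤ 2 * Real.pi := by positivity
    rw [neg_div, Real.rpow_neg (by positivity), ← Real.sqrt_eq_rpow, inv_pow]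
    congr 1
    rw [NNReal.coe_one, mul_one, eq_comm, Real.sqrt_eq_iff_mul_self_eq (by positivity) (by positivity), ← mul_pow,
      Real.mul_self_sqrt h0]
  · congr 1
    simp only [dotProduct, Finset.mul_sum]
    refine Finset.sum_congr rfl fun i _ => ?_
    simp; ring

open scoped MatrixOrder in
lemma gaussianVec_eq {k : ℕ} (μ : Fin k → ℝ) (S : Matrix (Fin k) (Fin k) ℝ) (hS : S.PosDef) :
    gaussianVec μ S = (multivariateGaussian (WithLp.toLp 2 μ) S).map WithLp.ofLp := by
  have hmeas : Measurable (WithLp.ofLp : EuclideanSpace ℝ (Fin k) → (Fin k → ℝ)) := by fun_prop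
  have hmeas' : Measurable (WithLp.toLp 2 : (Fin k → ℝ) → EuclideanSpace ℝ (Fin k)) := by fun_prop
  set A := CFC.sqrt S with hAdef
  have hAA : A * A = S := CFC.sqrt_mul_sqrt_self _ hS.posSemidef.nonneg
  have hAt : Aᵀ = A := by
    have : A.PosSemidef := by
      have := CFC.sqrt_nonneg S
      exact Matrix.nonneg_iff_posSemidef.mp this
    exact (by simpa using this.isHermitian : A.IsSymm)
  have hdet : A.det * A.det = S.det := by rw [← det_mul, hAA]
  have hSd := hS.det_pos
  have hAd : A.det ≠ 0 := by
    intro h; rw [h] at hdet; simp at hdet; linarith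
  have hinv : Aᵀ * S⁻¹ * A = 1 := by
    have hu : IsUnit A.det := isUnit_iff_ne_zero.mpr hAd
    rw [hAt, ← hAA, Matrix.mul_inv_rev, ← Matrix.mul_assoc, Matrix.mul_nonsing_inv _ hu, Matrix.one_mul,
      Matrix.nonsing_inv_mul _ hu]
  have e : (multivariateGaussian (WithLp.toLp 2 μ) S).map WithLp.ofLp =
      (Measure.pi fun _ : Fin k => gaussianReal 0 1).map (fun x => μ + A *ᵥ x) := by
    rw [multivariateGaussian, ← map_pi_eq_stdGaussian, Measure.map_map (by fun_prop) hmeas',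
      Measure.map_map hmeas (by fun_prop)]
    congr 1
  rw [e, pi_gaussian_density, gaussianVec]
  symm
  apply map_affine A hAd
  · apply Measurable.ennreal_ofReal
    apply Continuous.measurable
    fun_prop
  · intro x
    rw [prod_pdf, ← ENNReal.ofReal_mul (abs_nonneg _)]
    congr 1
    have hq : (μ + A *ᵥ x - μ) ⬝ᵥ (S⁻¹ *ᵥ (μ + A *ᵥ x - μ)) = x ⬝ᵥ x := by
      rw [add_sub_cancel_left, dotProduct_mulVec, ← Matrix.mulVec_transpose, Matrix.mulVec_mulVec,
        dotProduct_mulVec, ← Matrix.mulVec_transpose, Matrix.mulVec_mulVec]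
      have : Aᵀ * ((S⁻¹)ᵀ * A) = 1 := by
        rw [Matrix.transpose_nonsing_inv, show Sᵀ = S from (by simpa using hS.isHermitian : S.IsSymm), ← Matrix.mul_assoc, hinv]
      rw [this, Matrix.one_mulVec]
    rw [hq, Real.mul_rpow (by positivity) hSd.le, ← mul_assoc]
    congr 1
    rw [mul_comm |A.det|, mul_assoc, ← hdet, ← abs_mul_abs_self, neg_div, Real.rpow_neg (by positivity) (y := 1/2),
      Real.rpow_neg (by positivity), ← Real.sqrt_eq_rpow, ← Real.sqrt_eq_rpow, 
      Real.sqrt_mul_self (abs_nonneg _), inv_mul_cancel₀ (by simpa using hAd), mul_one]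

lemma row_step_aux {k : ℕ} (μ b : Fin k → ℝ) (S M : Matrix (Fin k) (Fin k) ℝ) (c : ℝ)
    (hS : S.PosSemidef) (hS' : (Mᵀ * S * M + c ^ 2 • (1 : Matrix (Fin k) (Fin k) ℝ)).PosSemidef) :
    ((multivariateGaussian (WithLp.toLp 2 μ) S).prod (stdGaussian (EuclideanSpace ℝ (Fin k)))).map
      (fun p => (WithLp.toLp 2 (p.1.ofLp ᵥ* M + b + c • p.2.ofLp) : EuclideanSpace ℝ (Fin k))) =
    multivariateGaussian (WithLp.toLp 2 (μ ᵥ* M + b))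
      (Mᵀ * S * M + c ^ 2 • (1 : Matrix (Fin k) (Fin k) ℝ)) := by
  have hF : Measurable (fun p : EuclideanSpace ℝ (Fin k) × EuclideanSpace ℝ (Fin k) =>
      (WithLp.toLp 2 (p.1.ofLp ᵥ* M + b + c • p.2.ofLp) : EuclideanSpace ℝ (Fin k))) := by
    apply Continuous.measurable; fun_prop
  have := Measure.isProbabilityMeasure_map (μ := (multivariateGaussian (WithLp.toLp 2 μ) S).prod
    (stdGaussian (EuclideanSpace ℝ (Fin k)))) hF.aemeasurable
  apply Measure.ext_of_charFun
  ext t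
  rw [charFun_multivariateGaussian hS', charFun_apply, integral_map hF.aemeasurable (by fun_prop)]
  have key : ∀ p : EuclideanSpace ℝ (Fin k) × EuclideanSpace ℝ (Fin k),
      Complex.exp ((inner ℝ (WithLp.toLp 2 (p.1.ofLp ᵥ* M + b + c • p.2.ofLp) :
        EuclideanSpace ℝ (Fin k)) t : ℝ) * Complex.I) =
      Complex.exp ((b ⬝ᵥ t.ofLp : ℝ) * Complex.I) *
      (Complex.exp ((inner ℝ p.1 (WithLp.toLp 2 (M *ᵥ t.ofLp)) : ℝ) * Complex.I) *
       Complex.exp ((inner ℝ p.2 (c • t) : ℝ) * Complex.I)) := by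
    intro p
    rw [← Complex.exp_add, ← Complex.exp_add]
    congr 1
    simp only [EuclideanSpace.inner_eq_star_dotProduct, star_trivial, WithLp.ofLp_smul]
    rw [dotProduct_add, dotProduct_add, dotProduct_comm t.ofLp (p.1.ofLp ᵥ* M), ← dotProduct_mulVec,
      dotProduct_comm (M *ᵥ t.ofLp), dotProduct_comm b, dotProduct_smul, smul_dotProduct]
    push_cast
    ring
  simp_rw [key]
  rw [integral_const_mul, integral_prod_mul (fun x : EuclideanSpace ℝ (Fin k) =>
    Complex.exp ((inner ℝ x (WithLp.toLp 2 (M *ᵥ t.ofLp)) : ℝ) * Complex.I))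
    (fun x : EuclideanSpace ℝ (Fin k) => Complex.exp ((inner ℝ x (c • t) : ℝ) * Complex.I)),
    ← charFun_apply, ← charFun_apply, charFun_multivariateGaussian hS, charFun_stdGaussian,
    ← Complex.exp_add, ← Complex.exp_add]
  congr 1
  have h1 : ((‖c • t‖ : ℝ) : ℂ) ^ 2 = ((c ^ 2 * (t.ofLp ⬝ᵥ t.ofLp) : ℝ) : ℂ) := by
    rw [← Complex.ofReal_pow, ← real_inner_self_eq_norm_sq, EuclideanSpace.inner_eq_star_dotProduct]
    congr 1
    simp only [star_trivial, WithLp.ofLp_smul, dotProduct_smul, smul_dotProduct, smul_eq_mul]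
    ring
  have h2 : (M *ᵥ t.ofLp) ⬝ᵥ (S *ᵥ (M *ᵥ t.ofLp)) = t.ofLp ⬝ᵥ ((Mᵀ * S * M) *ᵥ t.ofLp) := by
    rw [← Matrix.mulVec_mulVec, ← Matrix.mulVec_mulVec, dotProduct_mulVec t.ofLp Mᵀ, Matrix.vecMul_transpose]
  simp only [EuclideanSpace.inner_eq_star_dotProduct, star_trivial, h1, h2, Matrix.add_mulVec,
    Matrix.smul_mulVec, Matrix.one_mulVec, dotProduct_add, dotProduct_smul, add_dotProduct, smul_eq_mul,
    dotProduct_mulVec μ, dotProduct_mulVec, Complex.ofReal_add, Complex.ofReal_mul]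
  ring

lemma posDef_step {k : ℕ} (S M : Matrix (Fin k) (Fin k) ℝ) (c : ℝ) (hc : 0 < c)
    (hS : S.PosSemidef) : (Mᵀ * S * M + c ^ 2 • (1 : Matrix (Fin k) (Fin k) ℝ)).PosDef := by
  have h1 : (Mᵀ * S * M).PosSemidef := by
    simpa using hS.conjTranspose_mul_mul_same M
  have h2 : (c ^ 2 • (1 : Matrix (Fin k) (Fin k) ℝ)).PosDef := PosDef.one.smul (by positivity)
  exact h2.posSemidef_add h1

lemma row_step {k : ℕ} (μ b : Fin k → ℝ) (S M : Matrix (Fin k) (Fin k) ℝ) (c : ℝ) (hc : 0 < c)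
    (hS : S.PosDef) :
    ((gaussianVec μ S).prod (Measure.pi fun _ : Fin k => gaussianReal 0 1)).map
      (fun p => p.1 ᵥ* M + b + c • p.2) =
    gaussianVec (μ ᵥ* M + b) (Mᵀ * S * M + c ^ 2 • (1 : Matrix (Fin k) (Fin k) ℝ)) := by
  have hS' := posDef_step S M c hc hS.posSemidef
  have hmeas : Measurable (WithLp.ofLp : EuclideanSpace ℝ (Fin k) → (Fin k → ℝ)) := by fun_prop
  have hmeas' : Measurable (WithLp.toLp 2 : (Fin k → ℝ) → EuclideanSpace ℝ (Fin k)) := by fun_prop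
  have hF : Measurable (fun p : (Fin k → ℝ) × (Fin k → ℝ) => p.1 ᵥ* M + b + c • p.2) := by
    apply Continuous.measurable; fun_prop
  have hF' : Measurable (fun p : EuclideanSpace ℝ (Fin k) × EuclideanSpace ℝ (Fin k) =>
      (WithLp.toLp 2 (p.1.ofLp ᵥ* M + b + c • p.2.ofLp) : EuclideanSpace ℝ (Fin k))) := by
    apply Continuous.measurable; fun_prop
  have e : (Measure.pi fun _ : Fin k => gaussianReal 0 1) =
      (stdGaussian (EuclideanSpace ℝ (Fin k))).map WithLp.ofLp := by
    rw [← map_pi_eq_stdGaussian, Measure.map_map hmeas hmeas']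
    exact Measure.map_id.symm
  rw [gaussianVec_eq _ _ hS, gaussianVec_eq _ _ hS', ← row_step_aux _ _ _ _ _ hS.posSemidef hS'.posSemidef, e,
    Measure.map_prod_map _ _ hmeas hmeas, Measure.map_map hF (hmeas.prodMap hmeas),
    Measure.map_map hmeas hF']
  rfl

lemma gaussianVec_zero_one (k : ℕ) :
    gaussianVec (0 : Fin k → ℝ) 1 = Measure.pi fun _ : Fin k => gaussianReal 0 1 := by
  rw [pi_gaussian_density, gaussianVec]
  congr 1
  ext x
  rw [prod_pdf]
  simp

lemma gaussianVec_prob {k : ℕ} (μ : Fin k → ℝ) (S : Matrix (Fin k) (Fin k) ℝ) (hS : S.PosDef) :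
    IsProbabilityMeasure (gaussianVec μ S) := by
  rw [gaussianVec_eq _ _ hS]
  have hmeas : Measurable (WithLp.ofLp : EuclideanSpace ℝ (Fin k) → (Fin k → ℝ)) := by fun_prop
  exact Measure.isProbabilityMeasure_map hmeas.aemeasurable

lemma mat_step {n d : ℕ} (μ : Fin n → Fin d → ℝ) (B : Matrix (Fin n) (Fin d) ℝ)
    (S M : Matrix (Fin d) (Fin d) ℝ) (c : ℝ) (hc : 0 < c) (hS : S.PosDef) :
    Measure.map (fun p : Matrix (Fin n) (Fin d) ℝ × Matrix (Fin n) (Fin d) ℝ =>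
        p.1 * M + B + c • p.2)
      (Measure.prod (Measure.pi fun i : Fin n => gaussianVec (μ i) S : Measure (Matrix (Fin n) (Fin d) ℝ))
        (stdGaussianMatrix n d)) =
    Measure.pi fun i : Fin n => gaussianVec (μ i ᵥ* M + B i)
      (Mᵀ * S * M + c ^ 2 • (1 : Matrix (Fin d) (Fin d) ℝ)) := by
  have hp : ∀ i, IsProbabilityMeasure (gaussianVec (μ i) S) := fun i => gaussianVec_prob _ _ hS
  have h := (measurePreserving_arrowProdEquivProdArrow (Fin d → ℝ) (Fin d → ℝ) (Fin n)
    (fun i => gaussianVec (μ i) S) (fun _ => Measure.pi fun _ => gaussianReal 0 1)).map_eq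
  have hF : ∀ i, Measurable (fun p : (Fin d → ℝ) × (Fin d → ℝ) => p.1 ᵥ* M + B i + c • p.2) := by
    intro i
    apply Continuous.measurable; fun_prop
  have hG : Measurable (fun p : (Fin n → Fin d → ℝ) × (Fin n → Fin d → ℝ) =>
      fun i => p.1 i ᵥ* M + B i + c • p.2 i) := by
    apply Continuous.measurable; fun_prop
  have hpm : ∀ i, IsProbabilityMeasure (Measure.map
      (fun p : (Fin d → ℝ) × (Fin d → ℝ) => p.1 ᵥ* M + B i + c • p.2)
      ((gaussianVec (μ i) S).prod (Measure.pi fun _ : Fin d => gaussianReal 0 1))) :=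
    fun i => Measure.isProbabilityMeasure_map (hF i).aemeasurable
  have h2 := Measure.pi_map_pi (μ := fun i : Fin n => (gaussianVec (μ i) S).prod
    (Measure.pi fun _ : Fin d => gaussianReal 0 1))
    (f := fun i p => p.1 ᵥ* M + B i + c • p.2) (fun i => (hF i).aemeasurable)
  have h3 : Measure.map (fun p : (Fin n → Fin d → ℝ) × (Fin n → Fin d → ℝ) =>
      fun i => p.1 i ᵥ* M + B i + c • p.2 i)
      ((Measure.pi fun i : Fin n => gaussianVec (μ i) S).prod
        (Measure.pi fun _ : Fin n => Measure.pi fun _ : Fin d => gaussianReal 0 1)) =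
      Measure.pi fun i : Fin n => gaussianVec (μ i ᵥ* M + B i)
      (Mᵀ * S * M + c ^ 2 • (1 : Matrix (Fin d) (Fin d) ℝ)) := by
    rw [← h, Measure.map_map hG (MeasurableEquiv.measurable _)]
    simp_rw [row_step _ _ _ _ _ hc hS] at h2
    exact h2
  exact h3

lemma fold_measurable {E : Type*} [MeasurableSpace E] (F : E → E → E)
    (hF : Measurable fun p : E × E => F p.1 p.2) (t : ℕ) :
    Measurable (fun ω : E × (Fin t → E) => (List.ofFn ω.2).foldl F ω.1) := by
  induction t with
  | zero => simpa using measurable_fst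
  | succ t ih =>
    simp only [List.ofFn_succ_last, List.foldl_concat]
    have h1 : Measurable (fun ω : E × (Fin (t+1) → E) => (ω.1, fun i : Fin t => ω.2 i.castSucc)) := by
      fun_prop
    have h2 : Measurable (fun ω : E × (Fin (t+1) → E) => ω.2 (Fin.last t)) := by fun_prop
    exact hF.comp ((ih.comp h1).prodMk h2)

lemma fold_succ {E : Type*} [MeasurableSpace E] (F : E → E → E)
    (hF : Measurable fun p : E × E => F p.1 p.2) (Q P : Measure E)
    [IsProbabilityMeasure Q] [IsProbabilityMeasure P] (t : ℕ) :
    Measure.map (fun ω : E × (Fin (t+1) → E) => (List.ofFn ω.2).foldl F ω.1)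
      (Q.prod (Measure.pi fun _ : Fin (t+1) => P)) =
    Measure.map (fun p : E × E => F p.1 p.2)
      ((Measure.map (fun ω : E × (Fin t → E) => (List.ofFn ω.2).foldl F ω.1)
        (Q.prod (Measure.pi fun _ : Fin t => P))).prod P) := by
  have hf := fold_measurable F hF t
  have hf1 := fold_measurable F hF (t+1)
  set f := (fun ω : E × (Fin t → E) => (List.ofFn ω.2).foldl F ω.1) with hfdef
  have h1 := ((measurePreserving_piFinSuccAbove (fun _ : Fin (t+1) => P) (Fin.last t)).symm _)
  have h2 := Measure.measurePreserving_swap (μ := Measure.pi fun _ : Fin t => P) (ν := P)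
  have h3 := measurePreserving_prodAssoc Q (Measure.pi fun _ : Fin t => P) P
  have h4 := ((MeasurePreserving.id Q).prod (h1.comp h2)).comp h3
  rw [← h4.map_eq, Measure.map_map hf1 h4.measurable]
  have e : (Measure.map f (Q.prod (Measure.pi fun _ : Fin t => P))).prod P =
      Measure.map (Prod.map f id) ((Q.prod (Measure.pi fun _ : Fin t => P)).prod P) := by
    rw [← Measure.map_prod_map _ _ hf measurable_id, Measure.map_id]
  rw [e, Measure.map_map hF (hf.prodMap measurable_id)]
  congr 1
  ext ω
  obtain ⟨⟨a, b⟩, c⟩ := ω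
  simp only [Function.comp, hfdef, List.ofFn_succ_last, List.foldl_concat, Prod.map, id]
  simp [MeasurableEquiv.prodAssoc, MeasurableEquiv.piFinSuccAbove, Fin.insertNthEquiv]

theorem statement4 (m d n : ℕ) (hm : 1 ≤ m) (hd : 1 ≤ d) (hn : 1 ≤ n)
    (X : Matrix (Fin m) (Fin d) ℝ) (Y : Matrix (Fin m) (Fin n) ℝ)
    (lam η σ : ℝ) (hlam : 0 < lam) (hη : 0 < η) (hσ : 0 < σ)
    (Sig Mm : Matrix (Fin d) (Fin d) ℝ) (Bm : Matrix (Fin n) (Fin d) ℝ)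
    (hSig : Sig = (1 / (m : ℝ)) • (Xᵀ * X) + lam • (1 : Matrix (Fin d) (Fin d) ℝ))
    (hM : Mm = 1 - (2 * η) • Sig)
    (hB : Bm = (2 * η / (m : ℝ)) • (Yᵀ * X))
    -- η λ_max(Σ) < 1, i.e. η μ < 1 for every eigenvalue μ of Σ
    (heig : ∀ μ ∈ spectrum ℝ Sig, η * μ < 1) :
    ∀ t : ℕ, 1 ≤ t →
      Measure.map
        (fun ω : Matrix (Fin n) (Fin d) ℝ × (Fin t → Matrix (Fin n) (Fin d) ℝ) =>
          (List.ofFn ω.2).foldl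
            (fun v N => v * Mm + Bm + (Real.sqrt (2 * η) * σ) • N) ω.1)
        ((stdGaussianMatrix n d).prod (Measure.pi fun _ : Fin t => stdGaussianMatrix n d)) =
      Measure.pi (fun i : Fin n =>
        gaussianVec ((Bm i) ᵥ* ((1 - Mm)⁻¹ * (1 - Mm ^ t)))
          (Mm ^ (2 * t) + (2 * η * σ ^ 2) • ((1 - Mm ^ 2)⁻¹ * (1 - Mm ^ (2 * t))))) := by
  have hmR : (0:ℝ) < m := by exact_mod_cast hm
  have hXX : (Xᵀ * X).PosSemidef := by simpa using posSemidef_conjTranspose_mul_self X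
  have hSigP : Sig.PosDef := by
    rw [hSig]
    exact (PosDef.one.smul hlam).posSemidef_add (hXX.smul (by positivity))
  have hSt : Sigᵀ = Sig := (by simpa using hSigP.isHermitian : Sig.IsSymm)
  have hMt : Mmᵀ = Mm := by
    rw [hM]; simp [hSt]
  have hSu : IsUnit Sig := hSigP.isUnit
  have h1M : IsUnit (1 - Mm) := by
    have : 1 - Mm = (2 * η) • Sig := by rw [hM]; abel
    rw [this]
    exact (IsUnit.smul (Units.mk0 (2 * η) (by positivity)) hSu)
  have h1pM : IsUnit (1 + Mm) := by
    have hn : (1/η) ∉ spectrum ℝ Sig := by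
      intro h
      have := heig _ h
      rw [mul_one_div_cancel hη.ne'] at this
      exact lt_irrefl _ this
    rw [spectrum.mem_iff, not_not] at hn
    have : 1 + Mm = (2 * η) • (algebraMap ℝ (Matrix (Fin d) (Fin d) ℝ) (1/η) - Sig) := by
      rw [hM, smul_sub, Algebra.algebraMap_eq_smul_one, smul_smul,
        show 2 * η * (1 / η) = 2 by field_simp, two_smul]
      abel
    rw [this]
    exact (IsUnit.smul (Units.mk0 (2 * η) (by positivity)) hn)
  have h1M2 : IsUnit (1 - Mm ^ 2) := by
    have : 1 - Mm ^ 2 = (1 - Mm) * (1 + Mm) := by noncomm_ring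
    rw [this]; exact h1M.mul h1pM
  rw [Matrix.isUnit_iff_isUnit_det] at h1M h1M2
  set c := Real.sqrt (2 * η) * σ with hc
  have hcpos : 0 < c := by positivity
  have hc2 : c ^ 2 = 2 * η * σ ^ 2 := by
    rw [hc, mul_pow, Real.sq_sqrt (by positivity)]
  set μ : ℕ → Fin n → Fin d → ℝ := fun t i => (Bm i) ᵥ* ((1 - Mm)⁻¹ * (1 - Mm ^ t)) with hμ
  set S : ℕ → Matrix (Fin d) (Fin d) ℝ := fun t =>
    Mm ^ (2 * t) + (2 * η * σ ^ 2) • ((1 - Mm ^ 2)⁻¹ * (1 - Mm ^ (2 * t))) with hSdef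
  have hS0 : S 0 = 1 := by simp [hSdef]
  have hμ0 : ∀ i, μ 0 i = 0 := by intro i; simp [hμ]
  have hμs : ∀ t i, μ (t + 1) i = μ t i ᵥ* Mm + Bm i := by
    intro t i
    have e : (1 - Mm)⁻¹ * (1 - Mm ^ (t + 1)) = (1 - Mm)⁻¹ * (1 - Mm ^ t) * Mm + 1 := by
      have : (1 - Mm ^ (t + 1)) = (1 - Mm ^ t) * Mm + (1 - Mm) := by
        rw [pow_succ]; noncomm_ring
      rw [this, Matrix.mul_add, Matrix.nonsing_inv_mul _ h1M, Matrix.mul_assoc]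
    simp only [hμ]
    rw [e, Matrix.vecMul_add, Matrix.vecMul_one, Matrix.vecMul_vecMul]
  have hSs : ∀ t, S (t + 1) = Mmᵀ * S t * Mm + c ^ 2 • (1 : Matrix (Fin d) (Fin d) ℝ) := by
    intro t
    have hcomm : Mm * (1 - Mm ^ 2)⁻¹ = (1 - Mm ^ 2)⁻¹ * Mm := by
      have h : (1 - Mm ^ 2) * Mm = Mm * (1 - Mm ^ 2) := by noncomm_ring
      calc Mm * (1 - Mm ^ 2)⁻¹ = (1 - Mm ^ 2)⁻¹ * ((1 - Mm ^ 2) * Mm) * (1 - Mm ^ 2)⁻¹ := by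
            rw [← Matrix.mul_assoc, Matrix.nonsing_inv_mul _ h1M2, Matrix.one_mul]
        _ = _ := by
            rw [h, Matrix.mul_assoc, Matrix.mul_assoc Mm, Matrix.mul_nonsing_inv _ h1M2, Matrix.mul_one]
    have hp : Mm ^ (2 * (t + 1)) = Mm * Mm ^ (2 * t) * Mm := by
      rw [← pow_succ', ← pow_succ]; ring_nf
    have e : (1 - Mm ^ 2)⁻¹ * (1 - Mm ^ (2 * (t + 1))) =
        Mm * ((1 - Mm ^ 2)⁻¹ * (1 - Mm ^ (2 * t))) * Mm + 1 := by
      have : (1 - Mm ^ (2 * (t + 1))) = Mm * (1 - Mm ^ (2 * t)) * Mm + (1 - Mm ^ 2) := by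
        rw [hp]; noncomm_ring
      rw [this, Matrix.mul_add, Matrix.nonsing_inv_mul _ h1M2, ← Matrix.mul_assoc Mm, hcomm]
      simp only [Matrix.mul_assoc]
    simp only [hSdef]
    rw [e, hp, hMt, hc2, smul_add, Matrix.mul_add, Matrix.add_mul, Matrix.mul_smul, Matrix.smul_mul]
    abel
  have hSP : ∀ t, (S t).PosDef := by
    intro t
    induction t with
    | zero => rw [hS0]; exact PosDef.one
    | succ t ih => rw [hSs]; exact posDef_step _ _ _ hcpos ih.posSemidef
  have hF : Measurable (fun p : Matrix (Fin n) (Fin d) ℝ × Matrix (Fin n) (Fin d) ℝ =>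
      p.1 * Mm + Bm + c • p.2) := by
    have hG : Measurable (fun p : (Fin n → Fin d → ℝ) × (Fin n → Fin d → ℝ) =>
      fun i => p.1 i ᵥ* Mm + Bm i + c • p.2 i) := by
      apply Continuous.measurable; fun_prop
    exact hG
  have hP : IsProbabilityMeasure (stdGaussianMatrix n d) := by
    have : IsProbabilityMeasure (Measure.pi fun _ : Fin n => Measure.pi fun _ : Fin d =>
      gaussianReal 0 1) := inferInstance
    exact this
  intro t _
  show _ = Measure.pi (fun i => gaussianVec (μ t i) (S t))
  clear * - hSP hμs hSs hF hP hμ0 hS0 hcpos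
  induction t with
  | zero =>
    simp only [List.ofFn_zero, List.foldl_nil, hS0, hμ0, gaussianVec_zero_one]
    rw [← Measure.fst, Measure.fst_prod]
    rfl
  | succ t ih =>
    rw [fold_succ (fun v N => v * Mm + Bm + c • N) hF, ih]
    simp only [hμs, hSs]
    exact mat_step (μ t) Bm (S t) Mm c hcpos (hSP t)

end Paper
end
end

section
/- Let n, d, l ≥ 1 be integers, σ_θ, σ_z > 0, and v ∈ ℝ^{n×d} a deterministic matrix. Let N ∈ ℝ^{n×d} be a standard Gaussian matrix and Z ∈ ℝ^{d×l} a matrix with i.i.d. N(0, σ_z²) entries, independent of N. Then the characteristic function of the distribution P_v of (σ_θ N + v)Z satisfies, for every t ∈ ℝ^{n×l}: E[exp(i·tr(tᵀ(σ_θ N + v)Z))] = exp(−(σ_z²/2)·tr(tᵀ v vᵀ t (I_l + σ_z² σ_θ² tᵀt)⁻¹)) / det(I_l + σ_z² σ_θ² tᵀt)^{d/2}. -/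
open MeasureTheory ProbabilityTheory Matrix Set

noncomputable section
namespace Paper

/-- A random matrix with i.i.d. `N(0, v)` entries. -/
def gaussianMatrix (m n : ℕ) (v : NNReal) : Measure (Matrix (Fin m) (Fin n) ℝ) :=
  (Measure.pi fun _ : Fin m => Measure.pi fun _ : Fin n => gaussianReal 0 v)

lemma gauss1 (w : NNReal) (hw : w ≠ 0) (a c : ℝ) (ha : 0 ≤ a) :
    ∫ x : ℝ, Complex.exp (Complex.I * (c * x : ℝ) - (a / 2 * x ^ 2 : ℝ)) ∂(gaussianReal 0 w)
     = ((Real.exp (-(w / 2) * (c ^ 2 / (1 + w * a))) / √(1 + w * a) : ℝ) : ℂ) := by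
  rw [integral_gaussianReal_eq_integral_smul hw]
  have hw' : (0:ℝ) < w := by positivity
  have hpos : 0 < 1 + w * a := by positivity
  have e : ∀ x : ℝ, gaussianPDFReal 0 w x • Complex.exp (Complex.I * (c * x : ℝ) - (a / 2 * x ^ 2 : ℝ))
      = ((√(2 * Real.pi * w))⁻¹ : ℝ) * Complex.exp ((-((1 + w * a) / (2 * w) : ℝ) : ℂ) * x ^ 2 + (Complex.I * c) * x + 0) := by
    intro x
    rw [gaussianPDFReal, Complex.real_smul]
    push_cast
    rw [mul_assoc, ← Complex.exp_add]
    congr 2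
    have : (w : ℂ) ≠ 0 := by exact_mod_cast hw
    field_simp
    ring
  simp_rw [e]
  have hb : (-((1 + w * a) / (2 * w) : ℝ) : ℂ).re < 0 := by
    rw [Complex.neg_re, Complex.ofReal_re]
    have : 0 < (1 + w * a) / (2 * w) := by positivity
    linarith
  rw [integral_const_mul, integral_cexp_quadratic hb]
  have h1 : (Real.pi / -(-((1 + w * a) / (2 * w) : ℝ) : ℂ)) ^ (1 / 2 : ℂ)
      = ((√(Real.pi / ((1 + w * a) / (2 * w)))  : ℝ) : ℂ) := by
    rw [Real.sqrt_eq_rpow, Complex.ofReal_cpow (by positivity)]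
    push_cast
    simp
  rw [h1]
  have h2 : (0 - (Complex.I * c) ^ 2 / (4 * (-((1 + w * a) / (2 * w) : ℝ) : ℂ)))
      = ((-(w / 2) * (c ^ 2 / (1 + w * a)) : ℝ) : ℂ) := by
    rw [mul_pow, Complex.I_sq]
    push_cast
    have : (w : ℂ) ≠ 0 := by exact_mod_cast hw
    have : (1 + w * a : ℂ) ≠ 0 := by exact_mod_cast hpos.ne'
    field_simp
    ring
  rw [h2, ← Complex.ofReal_exp]
  rw [← Complex.ofReal_mul, ← Complex.ofReal_mul]
  congr 1
  have : Real.pi / ((1 + w * a) / (2 * w)) = (2 * Real.pi * w) / (1 + w * a) := by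
    field_simp
  rw [this, Real.sqrt_div (by positivity)]
  have : √(2 * Real.pi * w) ≠ 0 := by positivity
  have : √(1 + w * a) ≠ 0 := by positivity
  field_simp

lemma cf {ι : Type*} [Fintype ι] (w : NNReal) (b : ι → ℝ) :
    ∫ x : ι → ℝ, Complex.exp (Complex.I * ((∑ i, b i * x i : ℝ) : ℂ))
      ∂(Measure.pi fun _ : ι => gaussianReal 0 w)
     = ((Real.exp (-(w / 2) * ∑ i, b i ^ 2) : ℝ) : ℂ) := by
  have h1 : ∀ x : ι → ℝ, Complex.exp (Complex.I * ((∑ i, b i * x i : ℝ) : ℂ))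
      = ∏ i, (fun (i : ι) (y : ℝ) => Complex.exp (b i * y * Complex.I)) i (x i) := by
    intro x
    rw [← Complex.exp_sum]
    push_cast
    rw [mul_comm, Finset.sum_mul]
  simp_rw [h1]
  rw [integral_fintype_prod_eq_prod (f := fun (i : ι) (y : ℝ) => Complex.exp (b i * y * Complex.I))]
  simp_rw [← charFun_apply_real, charFun_gaussianReal]
  rw [← Complex.exp_sum]
  push_cast
  congr 1
  rw [Finset.mul_sum]
  refine Finset.sum_congr rfl fun i _ => ?_
  simp
  ring

lemma rot {l : ℕ} (w : NNReal) (U : Matrix (Fin l) (Fin l) ℝ) (hU : U * Uᵀ = 1) :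
    (Measure.pi fun _ : Fin l => gaussianReal 0 w).map (fun x => U *ᵥ x) =
      (Measure.pi fun _ : Fin l => gaussianReal 0 w) := by
  have hm : Measurable (fun x : Fin l → ℝ => U *ᵥ x) :=
    (Continuous.matrix_mulVec continuous_const continuous_id).measurable
  have : IsProbabilityMeasure ((Measure.pi fun _ : Fin l => gaussianReal 0 w).map (fun x => U *ᵥ x)) :=
    Measure.isProbabilityMeasure_map hm.aemeasurable
  apply (MeasurableEquiv.toLp 2 (Fin l → ℝ)).map_measurableEquiv_injective
  apply Measure.ext_of_charFun (E := EuclideanSpace ℝ (Fin l))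
  ext s
  rw [charFun_apply, charFun_apply, integral_map_equiv, integral_map_equiv]
  have k1 : ∀ x : Fin l → ℝ, Complex.exp ((inner ℝ (MeasurableEquiv.toLp 2 (Fin l → ℝ) x) s : ℝ) * Complex.I)
     = Complex.exp (Complex.I * ((∑ i, s.ofLp i * x i : ℝ) : ℂ)) := by
    intro x
    rw [mul_comm]; simp [PiLp.inner_apply]
  simp_rw [k1]
  rw [integral_map hm.aemeasurable (Continuous.aestronglyMeasurable (by fun_prop))]
  have k2 : ∀ x : Fin l → ℝ, (∑ i, s.ofLp i * (U *ᵥ x) i) = ∑ i, (s.ofLp ᵥ* U) i * x i := by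
    intro x
    exact dotProduct_mulVec s.ofLp U x
  simp_rw [k2]
  rw [cf, cf]
  have : ∑ i, (s.ofLp ᵥ* U) i ^ 2 = ∑ i, s.ofLp i ^ 2 := by
    have h := dotProduct_mulVec s.ofLp U (Uᵀ *ᵥ s.ofLp)
    rw [mulVec_mulVec, hU, one_mulVec, mulVec_transpose] at h
    simp only [pow_two]
    exact h.symm
  rw [this]

lemma gaussl {l : ℕ} (w : NNReal) (hw : w ≠ 0) (B : Matrix (Fin l) (Fin l) ℝ) (hB : B.PosSemidef)
    (b : Fin l → ℝ) :
    ∫ x : Fin l → ℝ, Complex.exp (Complex.I * (b ⬝ᵥ x : ℝ) - (1 / 2 * (x ⬝ᵥ B *ᵥ x) : ℝ))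
      ∂(Measure.pi fun _ : Fin l => gaussianReal 0 w)
    = ((Real.exp (-(w / 2) * (b ⬝ᵥ (1 + (w : ℝ) • B)⁻¹ *ᵥ b)) / √((1 + (w : ℝ) • B).det) : ℝ) : ℂ) := by
  obtain ⟨U, D, hU, hU', hD, hBe⟩ : ∃ (U : Matrix (Fin l) (Fin l) ℝ) (D : Fin l → ℝ),
      U * Uᵀ = 1 ∧ Uᵀ * U = 1 ∧ (∀ i, 0 ≤ D i) ∧ B = U * diagonal D * Uᵀ := by
    refine ⟨hB.1.eigenvectorUnitary, hB.1.eigenvalues, ?_, ?_, hB.eigenvalues_nonneg, ?_⟩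
    · exact Unitary.coe_mul_star_self hB.1.eigenvectorUnitary
    · exact Unitary.coe_star_mul_self hB.1.eigenvectorUnitary
    · exact hB.1.spectral_theorem
  have hpos : ∀ i, 0 < 1 + w * D i := fun i => by have := hD i; positivity
  have hA : (1 + (w : ℝ) • B) = U * diagonal (fun i => 1 + w * D i) * Uᵀ := by
    have : diagonal (fun i => 1 + w * D i) = 1 + (w : ℝ) • diagonal D := by
      ext i j
      by_cases h : i = j <;> simp [h, Matrix.diagonal, one_apply]
    rw [this, mul_add, add_mul, mul_one, hU, hBe]
    simp
  have hdet : (1 + (w : ℝ) • B).det = ∏ i, (1 + w * D i) := by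
    rw [hA, det_mul_right_comm, hU, one_mul, det_diagonal]
  have hinv : (1 + (w : ℝ) • B)⁻¹ = U * diagonal (fun i => (1 + w * D i)⁻¹) * Uᵀ := by
    apply inv_eq_right_inv
    rw [hA]
    calc _ = U * diagonal (fun i => 1 + w * D i) * (Uᵀ * U) * diagonal (fun i => (1 + w * D i)⁻¹) * Uᵀ := by
          simp only [Matrix.mul_assoc]
      _ = U * (diagonal (fun i => 1 + w * D i) * diagonal (fun i => (1 + w * D i)⁻¹)) * Uᵀ := by
          rw [hU', Matrix.mul_one]; simp only [Matrix.mul_assoc]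
      _ = 1 := by
          rw [diagonal_mul_diagonal]
          simp [fun i => mul_inv_cancel₀ (hpos i).ne', hU]
  have hm : Measurable (fun x : Fin l → ℝ => U *ᵥ x) :=
    (Continuous.matrix_mulVec continuous_const continuous_id).measurable
  rw [← rot w U hU, integral_map hm.aemeasurable (Continuous.aestronglyMeasurable (by fun_prop))]
  set c := b ᵥ* U with hc
  have e1 : ∀ x, b ⬝ᵥ U *ᵥ x = ∑ i, c i * x i := fun x => dotProduct_mulVec _ _ _
  have e0 : ∀ (E : Fin l → ℝ) (x : Fin l → ℝ), x ⬝ᵥ (U * diagonal E * Uᵀ) *ᵥ x = ∑ i, E i * (x ᵥ* U) i ^ 2 := by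
    intro E x
    rw [← mulVec_mulVec, ← mulVec_mulVec, dotProduct_mulVec, mulVec_transpose]
    simp only [dotProduct, mulVec_diagonal]
    exact Finset.sum_congr rfl fun i _ => by ring
  have e2 : ∀ x, (U *ᵥ x) ⬝ᵥ B *ᵥ (U *ᵥ x) = ∑ i, D i * x i ^ 2 := by
    intro x
    rw [hBe, e0, ← mulVec_transpose, mulVec_mulVec, hU', one_mulVec]
  have h1 : ∀ x : Fin l → ℝ, Complex.exp (Complex.I * (b ⬝ᵥ U *ᵥ x : ℝ) - (1 / 2 * ((U *ᵥ x) ⬝ᵥ B *ᵥ (U *ᵥ x)) : ℝ))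
      = ∏ i, (fun (i : Fin l) (y : ℝ) => Complex.exp (Complex.I * (c i * y : ℝ) - (D i / 2 * y ^ 2 : ℝ))) i (x i) := by
    intro x
    rw [← Complex.exp_sum, e1, e2, Finset.sum_sub_distrib, ← Finset.mul_sum]
    push_cast
    congr 2
    rw [Finset.mul_sum]
    exact Finset.sum_congr rfl fun i _ => by ring
  simp_rw [h1]
  rw [integral_fintype_prod_eq_prod (f := fun (i : Fin l) (y : ℝ) => Complex.exp (Complex.I * (c i * y : ℝ) - (D i / 2 * y ^ 2 : ℝ)))]
  simp_rw [fun i => gauss1 w hw (D i) (c i) (hD i)]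
  rw [← Complex.ofReal_prod, Finset.prod_div_distrib, ← Real.exp_sum, hdet, hinv, e0, ← hc, Finset.mul_sum,
    Real.sqrt_prod _ (fun i _ => (hpos i).le)]
  congr 3
  exact Finset.sum_congr rfl fun i _ => by ring

lemma intN {n d : ℕ} (M : Matrix (Fin n) (Fin d) ℝ) :
    ∫ N : Fin n → Fin d → ℝ, Complex.exp (Complex.I * ((∑ i, ∑ j, M i j * N i j : ℝ) : ℂ))
      ∂(Measure.pi fun _ : Fin n => Measure.pi fun _ : Fin d => gaussianReal 0 1)
    = ((Real.exp (-(1 / 2) * ∑ i, ∑ j, M i j ^ 2) : ℝ) : ℂ) := by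
  have h1 : ∀ x : Fin n → Fin d → ℝ, Complex.exp (Complex.I * ((∑ i, ∑ j, M i j * x i j : ℝ) : ℂ))
      = ∏ i, (fun (i : Fin n) (y : Fin d → ℝ) => Complex.exp (Complex.I * ((∑ j, M i j * y j : ℝ) : ℂ))) i (x i) := by
    intro x
    rw [← Complex.exp_sum, ← Finset.mul_sum, Complex.ofReal_sum]
  simp_rw [h1]
  rw [integral_fintype_prod_eq_prod (f := fun (i : Fin n) (y : Fin d → ℝ) => Complex.exp (Complex.I * ((∑ j, M i j * y j : ℝ) : ℂ)))]
  simp_rw [cf]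
  rw [← Complex.ofReal_prod, ← Real.exp_sum, ← Finset.mul_sum]
  simp

lemma trace_expand {n d l : ℕ} (σ : ℝ) (v N : Matrix (Fin n) (Fin d) ℝ) (t : Matrix (Fin n) (Fin l) ℝ)
    (Z : Matrix (Fin d) (Fin l) ℝ) :
    Matrix.trace (tᵀ * ((σ • N + v) * Z)) =
      (∑ i, ∑ j, (σ • (t * Zᵀ)) i j * N i j) + ∑ j, (tᵀ * v)ᵀ j ⬝ᵥ Z j := by
  rw [Matrix.add_mul, Matrix.mul_add, Matrix.trace_add]
  congr 1
  · rw [← Matrix.mul_assoc, Matrix.trace_mul_comm, ← Matrix.mul_assoc, ← Matrix.trace_transpose, Matrix.transpose_mul]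
    simp only [Matrix.trace, Matrix.diag, Matrix.mul_apply (M := (σ • N)ᵀ), Matrix.transpose_mul,
      Matrix.transpose_transpose]
    rw [Finset.sum_comm]
    simp only [Matrix.smul_apply, Matrix.transpose_apply, smul_eq_mul]
    exact Finset.sum_congr rfl fun i _ => Finset.sum_congr rfl fun j _ => by ring
  · rw [← Matrix.mul_assoc, Matrix.trace_mul_comm, ← Matrix.trace_transpose, Matrix.transpose_mul]
    rfl

theorem statement5 (n d l : ℕ) (hn : 1 ≤ n) (hd : 1 ≤ d) (hl : 1 ≤ l)
    (σθ σz : ℝ) (hσθ : 0 < σθ) (hσz : 0 < σz)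
    (v : Matrix (Fin n) (Fin d) ℝ) (t : Matrix (Fin n) (Fin l) ℝ) :
    (∫ ω : Matrix (Fin n) (Fin d) ℝ × Matrix (Fin d) (Fin l) ℝ,
        Complex.exp (Complex.I *
          ((Matrix.trace (tᵀ * ((σθ • ω.1 + v) * ω.2)) : ℝ) : ℂ))
        ∂((stdGaussianMatrix n d).prod (gaussianMatrix d l (σz ^ 2).toNNReal))) =
      ((Real.exp (-(σz ^ 2 / 2) *
          Matrix.trace (tᵀ * v * vᵀ * t *
            ((1 : Matrix (Fin l) (Fin l) ℝ) + (σz ^ 2 * σθ ^ 2) • (tᵀ * t))⁻¹)) /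
        ((1 : Matrix (Fin l) (Fin l) ℝ) + (σz ^ 2 * σθ ^ 2) • (tᵀ * t)).det ^ ((d : ℝ) / 2)
        : ℝ) : ℂ) := by
  have hw : (σz ^ 2).toNNReal ≠ 0 := by
    have : 0 < σz ^ 2 := by positivity
    simpa using this.ne'
  have hwc : (((σz ^ 2).toNNReal : NNReal) : ℝ) = σz ^ 2 := Real.coe_toNNReal _ (by positivity)
  set w := (σz ^ 2).toNNReal with hwdef
  rw [← hwc]
  set B : Matrix (Fin l) (Fin l) ℝ := σθ ^ 2 • (tᵀ * t) with hBdef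
  have hB : B.PosSemidef := by
    have := Matrix.posSemidef_conjTranspose_mul_self t
    rw [Matrix.conjTranspose_eq_transpose_of_trivial] at this
    exact this.smul (by positivity)
  have hA : (1 : Matrix (Fin l) (Fin l) ℝ) + ((w : ℝ) * σθ ^ 2) • (tᵀ * t) = 1 + (w : ℝ) • B := by
    rw [hBdef, smul_smul]
  rw [hA]
  simp_rw [trace_expand]
  change ∫ ω : (Fin n → Fin d → ℝ) × (Fin d → Fin l → ℝ),
        Complex.exp (Complex.I *
          (((∑ i, ∑ j, (σθ • (t * (Matrix.of ω.2)ᵀ)) i j * ω.1 i j) + ∑ j, (tᵀ * v)ᵀ j ⬝ᵥ ω.2 j : ℝ) : ℂ))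
        ∂((Measure.pi fun _ : Fin n => Measure.pi fun _ : Fin d => gaussianReal 0 1).prod
          (Measure.pi fun _ : Fin d => Measure.pi fun _ : Fin l => gaussianReal 0 w)) = _
  have hcont : Continuous fun ω : (Fin n → Fin d → ℝ) × (Fin d → Fin l → ℝ) =>
        Complex.exp (Complex.I *
          (((∑ i, ∑ j, (σθ • (t * (Matrix.of ω.2)ᵀ)) i j * ω.1 i j) + ∑ j, (tᵀ * v)ᵀ j ⬝ᵥ ω.2 j : ℝ) : ℂ)) := by
    simp only [Matrix.smul_apply, Matrix.mul_apply, dotProduct, Matrix.transpose_apply, Matrix.of_apply]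
    fun_prop
  rw [integral_prod_symm]
  swap
  · refine Integrable.of_bound hcont.aestronglyMeasurable 1 (Filter.Eventually.of_forall fun ω => ?_)
    rw [mul_comm, Complex.norm_exp_ofReal_mul_I]
  simp only [Complex.ofReal_add, mul_add, Complex.exp_add]
  simp_rw [integral_mul_const, intN]
  have h1 : ∀ Z : Fin d → Fin l → ℝ,
      ((Real.exp (-(1 / 2) * ∑ i, ∑ j, (σθ • (t * (Matrix.of Z)ᵀ)) i j ^ 2) : ℝ) : ℂ) *
        Complex.exp (Complex.I * ((∑ j, (tᵀ * v)ᵀ j ⬝ᵥ Z j : ℝ) : ℂ)) =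
      ∏ j, (fun (j : Fin d) (z : Fin l → ℝ) => Complex.exp (Complex.I * ((tᵀ * v)ᵀ j ⬝ᵥ z : ℝ) - (1 / 2 * (z ⬝ᵥ B *ᵥ z) : ℝ))) j (Z j) := by
    intro Z
    have hq : ∑ j, ∑ i, (σθ • (t * (Matrix.of Z)ᵀ)) i j ^ 2 = ∑ j, Z j ⬝ᵥ B *ᵥ Z j := by
      refine Finset.sum_congr rfl fun j _ => ?_
      rw [hBdef, Matrix.smul_mulVec, dotProduct_smul, ← mulVec_mulVec, dotProduct_mulVec, vecMul_transpose, smul_eq_mul,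
        dotProduct, Finset.mul_sum]
      refine Finset.sum_congr rfl fun i _ => ?_
      have : (t * (Matrix.of Z)ᵀ) i j = (t *ᵥ Z j) i := rfl
      rw [Matrix.smul_apply, this, smul_eq_mul]
      ring
    rw [← Complex.exp_sum, Finset.sum_sub_distrib, ← Finset.mul_sum, ← Complex.ofReal_sum, ← Complex.ofReal_sum,
      Complex.ofReal_exp, ← Complex.exp_add, ← Finset.mul_sum, sub_eq_neg_add, ← Complex.ofReal_neg, Finset.sum_comm,
      neg_mul, hq]
  simp_rw [h1]
  rw [integral_fintype_prod_eq_prod (f := fun (j : Fin d) (z : Fin l → ℝ) => Complex.exp (Complex.I * ((tᵀ * v)ᵀ j ⬝ᵥ z : ℝ) - (1 / 2 * (z ⬝ᵥ B *ᵥ z) : ℝ)))]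
  simp_rw [gaussl w hw B hB]
  rw [← Complex.ofReal_prod, Finset.prod_div_distrib, ← Real.exp_sum, ← Finset.mul_sum]
  have hdet : 0 ≤ (1 + (w : ℝ) • B).det :=
    (Matrix.PosSemidef.one.add (hB.smul w.coe_nonneg)).det_nonneg
  congr 2
  · congr 2
    have : tᵀ * v * vᵀ * t = (tᵀ * v) * (tᵀ * v)ᵀ := by
      rw [Matrix.transpose_mul, Matrix.transpose_transpose, Matrix.mul_assoc, Matrix.mul_assoc]
    rw [this, Matrix.mul_assoc, Matrix.trace_mul_comm, Matrix.mul_assoc, Matrix.trace]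
    simp only [Matrix.diag]
    exact Finset.sum_congr rfl fun i _ => rfl
  · rw [Finset.prod_const, Finset.card_univ, Fintype.card_fin, Real.sqrt_eq_rpow, ← Real.rpow_natCast,
      ← Real.rpow_mul hdet]
    congr 1
    ring

end Paper
end
end

section
/- Let P, Q, P̃, Q̃ be four probability distributions on ℝ^d, and let γ = max(TV(P̃, P), TV(Q̃, Q)). Then for every α ∈ (γ, 1−γ): T(P̃, Q̃)(α + γ) − γ ≤ T(P, Q)(α) ≤ T(P̃, Q̃)(α − γ) + γ. -/
open MeasureTheory ProbabilityTheory Set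

noncomputable section

namespace Paper

/-- Total variation distance between two measures. -/
def TVdist {E : Type*} [MeasurableSpace E] (P Q : Measure E) : ℝ :=
  ⨆ s : {s : Set E // MeasurableSet s}, |(P s.1).toReal - (Q s.1).toReal|

theorem int_le {E : Type*} [MeasurableSpace E] (P Q : Measure E)
    [IsProbabilityMeasure P] [IsProbabilityMeasure Q] (φ : E → ℝ) (hm : Measurable φ)
    (h : ∀ x, 0 ≤ φ x ∧ φ x ≤ 1) : |(∫ x, φ x ∂P) - ∫ x, φ x ∂Q| ≤ TVdist P Q := by
  have hint : ∀ (R : Measure E) [IsProbabilityMeasure R], Integrable φ R := fun R _ =>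
    Integrable.of_bound hm.aestronglyMeasurable 1
      (Filter.Eventually.of_forall fun x => by
        rw [Real.norm_eq_abs, abs_of_nonneg (h x).1]; exact (h x).2)
  have key : ∀ (R : Measure E) [IsProbabilityMeasure R],
      (∫ x, φ x ∂(R)) = ∫ t in Ioc (0:ℝ) 1, R.real {a | t ≤ φ a} := fun R _ =>
    (hint R).integral_eq_integral_Ioc_meas_le
      (Filter.Eventually.of_forall fun x => (h x).1)
      (Filter.Eventually.of_forall fun x => (h x).2)
  have hI : ∀ (R : Measure E) [IsProbabilityMeasure R],
      IntegrableOn (fun t : ℝ => R.real {a | t ≤ φ a}) (Ioc (0:ℝ) 1) := by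
    intro R _
    have ha : Antitone (fun t : ℝ => R.real {a | t ≤ φ a}) := fun s t hst =>
      measureReal_mono (fun a (ha : t ≤ φ a) => hst.trans ha)
    exact Integrable.of_bound ha.measurable.aestronglyMeasurable 1
      (Filter.Eventually.of_forall fun x => by
        rw [Real.norm_eq_abs, abs_of_nonneg measureReal_nonneg]; exact measureReal_le_one)
  rw [key P, key Q, ← integral_sub (hI P) (hI Q), ← Real.norm_eq_abs]
  have hb : BddAbove (range fun s : {s : Set E // MeasurableSet s} =>
      |(P s.1).toReal - (Q s.1).toReal|) := by
    refine ⟨1, ?_⟩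
    rintro _ ⟨s, rfl⟩
    have h1 : P.real s.1 ≤ 1 := measureReal_le_one
    have h2 : Q.real s.1 ≤ 1 := measureReal_le_one
    have h3 : 0 ≤ P.real s.1 := measureReal_nonneg
    have h4 : 0 ≤ Q.real s.1 := measureReal_nonneg
    change |P.real s.1 - Q.real s.1| ≤ 1
    rw [abs_le]
    constructor <;> linarith
  have := norm_setIntegral_le_of_norm_le_const (μ := volume) (s := Ioc (0:ℝ) 1)
    (f := fun t => P.real {a | t ≤ φ a} - Q.real {a | t ≤ φ a}) (C := TVdist P Q)
    (by simp) (fun t _ => by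
      rw [Real.norm_eq_abs]
      exact le_ciSup hb ⟨{a | t ≤ φ a}, measurableSet_le measurable_const hm⟩)
  simpa using this

theorem half {E : Type*} [MeasurableSpace E] (P Q P' Q' : Measure E)
    [IsProbabilityMeasure Q'] (γ α : ℝ) (hα : 0 ≤ α)
    (h : ∀ φ : E → ℝ, Measurable φ → (∀ x, 0 ≤ φ x ∧ φ x ≤ 1) →
      |(∫ x, φ x ∂P') - ∫ x, φ x ∂P| ≤ γ ∧ |(∫ x, φ x ∂Q') - ∫ x, φ x ∂Q| ≤ γ) :
    tradeOff P' Q' (α + γ) - γ ≤ tradeOff P Q α := by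
  refine le_csInf ⟨1, fun _ => 0, measurable_const, by simp, by simpa using hα, by simp⟩ ?_
  rintro _ ⟨φ, hm, hφ, hP, rfl⟩
  obtain ⟨h1, h2⟩ := h φ hm hφ
  rw [abs_le] at h1 h2
  have : tradeOff P' Q' (α + γ) ≤ 1 - ∫ x, φ x ∂Q' := by
    refine csInf_le ⟨0, ?_⟩ ⟨φ, hm, hφ, by linarith, rfl⟩
    rintro _ ⟨ψ, hm, hψ, -, rfl⟩
    have : ∫ x, ψ x ∂Q' ≤ ∫ x, (1:ℝ) ∂Q' :=
      integral_mono_of_nonneg (Filter.Eventually.of_forall fun x => (hψ x).1)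
        (integrable_const _) (Filter.Eventually.of_forall fun x => (hψ x).2)
    simp at this
    linarith
  linarith

theorem statement6 (d : ℕ) (P Q P' Q' : Measure (Fin d → ℝ))
    [IsProbabilityMeasure P] [IsProbabilityMeasure Q]
    [IsProbabilityMeasure P'] [IsProbabilityMeasure Q']
    (γ : ℝ) (hγ : γ = max (TVdist P' P) (TVdist Q' Q))
    (α : ℝ) (hα : α ∈ Ioo γ (1 - γ)) :
    tradeOff P' Q' (α + γ) - γ ≤ tradeOff P Q α ∧
      tradeOff P Q α ≤ tradeOff P' Q' (α - γ) + γ := by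
  have hb : ∀ φ : (Fin d → ℝ) → ℝ, Measurable φ → (∀ x, 0 ≤ φ x ∧ φ x ≤ 1) →
      |(∫ x, φ x ∂P') - ∫ x, φ x ∂P| ≤ γ ∧ |(∫ x, φ x ∂Q') - ∫ x, φ x ∂Q| ≤ γ := by
    intro φ hm h
    rw [hγ]
    exact ⟨(int_le P' P φ hm h).trans (le_max_left _ _),
      (int_le Q' Q φ hm h).trans (le_max_right _ _)⟩
  have h0 : 0 ≤ γ := by
    rw [hγ]
    exact le_max_of_le_left (Real.iSup_nonneg fun _ => abs_nonneg _)
  refine ⟨half P Q P' Q' γ α (h0.trans hα.1.le) hb, ?_⟩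
  have := half P' Q' P Q γ (α - γ) (by linarith [hα.1]) (fun φ hm h => by
    rw [abs_sub_comm, abs_sub_comm (∫ x, φ x ∂Q)]
    exact hb φ hm h)
  rw [sub_add_cancel] at this
  linarith

end Paper
end
end

section
/- There exists a universal constant C > 0 such that for every integer d ≥ 1, all σ_θ, σ_z > 0, all row vectors v, w ∈ ℝ^{1×d}, and every α ∈ (C/d, 1 − C/d): G̃_{(√(dσ_θ²+‖v‖²), √(dσ_θ²+‖w‖²))}(α + C/d) − C/d ≤ T(VZ, WZ)(α) ≤ G̃_{(√(dσ_θ²+‖v‖²), √(dσ_θ²+‖w‖²))}(α − C/d) + C/d, where N ∈ ℝ^{1×d} is a standard Gaussian row vector, Z ∈ ℝ^d has i.i.d. N(0,σ_z²) entries independent of N, V = σ_θ N + v and W = σ_θ N + w (so VZ, WZ ∈ ℝ). -/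
open MeasureTheory ProbabilityTheory Set

noncomputable section

namespace Paper

/-- The trade-off function `G̃_{(σ₁,σ₂)}` between `N(0,σ₁²)` and `N(0,σ₂²)`. -/
def Gtilde (σ1 σ2 α : ℝ) : ℝ :=
  if σ1 ≤ σ2 then 2 * Φ ((σ1 / σ2) * Φinv (1 - α / 2)) - 1
  else 2 - 2 * Φ ((σ1 / σ2) * Φinv ((α + 1) / 2))

/-- The law of the scalar `(σθ N + u) Z` for `N` a standard Gaussian row vector in `ℝ^{1×d}`
and `Z ∈ ℝ^d` an independent vector with i.i.d. `N(0,σz²)` entries. -/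
def scalarProductLaw (d : ℕ) (σθ σz : ℝ) (u : Fin d → ℝ) : Measure ℝ :=
  Measure.map
    (fun ω : (Fin d → ℝ) × (Fin d → ℝ) => ∑ j, (σθ * ω.1 j + u j) * ω.2 j)
    ((Measure.pi fun _ : Fin d => gaussianReal 0 1).prod
      (Measure.pi fun _ : Fin d => gaussianReal 0 (σz ^ 2).toNNReal))

def hh (y r : ℝ) : ℝ := -(1/2) * Real.log r - y^2 / (2*r)
def hh1 (y r : ℝ) : ℝ := -(1/(2*r)) + y^2 / (2*r^2)
def hh2 (y r : ℝ) : ℝ := 1/(2*r^2) - y^2 / r^3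
def MM (y : ℝ) : ℝ := 2 * Real.exp (-(1/4) * y^2) * ((1+2*y^2)^2 + (2 + 8*y^2))

lemma hh_deriv (y r : ℝ) (hr : 0 < r) : HasDerivAt (hh y) (hh1 y r) r := by
  unfold hh hh1
  have h1 := (Real.hasDerivAt_log hr.ne').const_mul (-(1/2))
  have h2 := ((hasDerivAt_id r).const_mul 2).inv (by simpa using hr.ne')
  have h3 := (h2.const_mul (y^2))
  refine (h1.sub h3).congr_deriv ?_
  simp only [id]
  field_simp
  ring

lemma hh1_deriv (y r : ℝ) (hr : 0 < r) : HasDerivAt (hh1 y) (hh2 y r) r := by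
  unfold hh1 hh2
  have h2 := ((hasDerivAt_id r).const_mul 2).inv (by simpa using hr.ne')
  have h4 := (((hasDerivAt_id r).pow 2).const_mul 2).inv (by simpa using hr.ne')
  have h3 := (h4.const_mul (y^2))
  have := (h2.neg.add h3)
  have e : (fun r : ℝ => -(1/(2*r)) + y^2 / (2*r^2)) =
      (-(fun y => 2 * id y)⁻¹ + fun y_1 => y ^ 2 * (fun y => 2 * (id ^ 2) y)⁻¹ y_1) := by
    ext x; simp [div_eq_mul_inv]
  rw [e]
  refine this.congr_deriv ?_
  simp only [id, Pi.pow_apply]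
  field_simp
  ring

def ff (y r : ℝ) : ℝ := (Real.sqrt (2*Real.pi))⁻¹ * Real.exp (hh y r)
def ff1 (y r : ℝ) : ℝ := ff y r * hh1 y r
def ff2 (y r : ℝ) : ℝ := ff y r * (hh1 y r ^2 + hh2 y r)

lemma ff_deriv (y r : ℝ) (hr : 0 < r) : HasDerivAt (ff y) (ff1 y r) r := by
  refine (((hh_deriv y r hr).exp).const_mul _).congr_deriv ?_
  unfold ff1 ff; ring

lemma ff1_deriv (y r : ℝ) (hr : 0 < r) : HasDerivAt (ff1 y) (ff2 y r) r := by
  refine ((ff_deriv y r hr).mul (hh1_deriv y r hr)).congr_deriv ?_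
  unfold ff2 ff1; ring

lemma ff_bound (y r : ℝ) (hr : r ∈ Icc (1/2:ℝ) 2) :
    0 ≤ ff y r ∧ ff y r ≤ 2 * Real.exp (-(1/4) * y^2) := by
  obtain ⟨h1, h2⟩ := hr
  have hr : 0 < r := by linarith
  unfold ff
  refine ⟨by positivity, ?_⟩
  have hc : (Real.sqrt (2*Real.pi))⁻¹ ≤ 1 := by
    apply inv_le_one_of_one_le₀
    rw [Real.one_le_sqrt]
    linarith [Real.pi_gt_three]
  have he : Real.exp (hh y r) ≤ 2 * Real.exp (-(1/4) * y^2) := by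
    have : (2:ℝ) = Real.exp (Real.log 2) := by rw [Real.exp_log]; norm_num
    rw [this, ← Real.exp_add]
    apply Real.exp_le_exp.2
    unfold hh
    have l1 : Real.log (1/2) ≤ Real.log r := Real.log_le_log (by norm_num) h1
    have l2 : Real.log (1/2:ℝ) = - Real.log 2 := by rw [one_div, Real.log_inv]
    have l3 : 0 < Real.log 2 := Real.log_pos (by norm_num)
    have l4 : y^2/4 ≤ y^2/(2*r) := by
      apply div_le_div_of_nonneg_left (by positivity) (by positivity) (by linarith)
    linarith
  calc _ ≤ 1 * Real.exp (hh y r) := by gcongr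
    _ ≤ _ := by linarith

lemma hh1_bound (y r : ℝ) (hr : r ∈ Icc (1/2:ℝ) 2) : |hh1 y r| ≤ 1 + 2*y^2 := by
  obtain ⟨h1, h2⟩ := hr
  have hr : 0 < r := by linarith
  unfold hh1
  have a1 : 1/(2*r) ≤ 1 := by rw [div_le_one (by positivity)]; linarith
  have a2 : y^2/(2*r^2) ≤ 2*y^2 := by
    rw [div_le_iff₀ (by positivity)]
    nlinarith [sq_nonneg y, mul_nonneg (sq_nonneg y) (by nlinarith : 0 ≤ 4*r^2-1)]
  have : 0 ≤ 1/(2*r) := by positivity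
  have : 0 ≤ y^2/(2*r^2) := by positivity
  rw [abs_le]; constructor <;> linarith [sq_nonneg y]

lemma hh2_bound (y r : ℝ) (hr : r ∈ Icc (1/2:ℝ) 2) : |hh2 y r| ≤ 2 + 8*y^2 := by
  obtain ⟨h1, h2⟩ := hr
  have hr : 0 < r := by linarith
  unfold hh2
  have a1 : 1/(2*r^2) ≤ 2 := by rw [div_le_iff₀ (by positivity)]; nlinarith
  have a2 : y^2/r^3 ≤ 8*y^2 := by
    have : (1/2:ℝ)^3 ≤ r^3 := by gcongr
    rw [div_le_iff₀ (by positivity)]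
    nlinarith [sq_nonneg y, mul_nonneg (sq_nonneg y) (by linarith : 0 ≤ 8*r^3-1)]
  have : 0 ≤ 1/(2*r^2) := by positivity
  have : 0 ≤ y^2/r^3 := by positivity
  rw [abs_le]; constructor <;> linarith [sq_nonneg y]

lemma ff2_bound (y r : ℝ) (hr : r ∈ Icc (1/2:ℝ) 2) : |ff2 y r| ≤ MM y := by
  unfold ff2 MM
  obtain ⟨h0, h1⟩ := ff_bound y r hr
  rw [abs_mul, abs_of_nonneg h0]
  apply mul_le_mul h1 _ (abs_nonneg _) (by positivity)
  refine (abs_add_le _ _).trans ?_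
  rw [abs_pow]
  gcongr
  · exact hh1_bound y r hr
  · exact hh2_bound y r hr

lemma ff1_bound (y r : ℝ) (hr : r ∈ Icc (1/2:ℝ) 2) : |ff1 y r| ≤ MM y := by
  unfold ff1 MM
  obtain ⟨h0, h1⟩ := ff_bound y r hr
  rw [abs_mul, abs_of_nonneg h0]
  apply mul_le_mul h1 _ (abs_nonneg _) (by positivity)
  refine (hh1_bound y r hr).trans ?_
  nlinarith [sq_nonneg y, sq_nonneg (y^2)]

lemma ff_taylor (y r : ℝ) (hr : r ∈ Icc (1/2:ℝ) 2) :
    |ff y r - ff y 1 - ff1 y 1 * (r - 1)| ≤ MM y * (r-1)^2 := by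
  have one_mem : (1:ℝ) ∈ Icc (1/2:ℝ) 2 := by constructor <;> norm_num
  have hM : 0 ≤ MM y := (abs_nonneg _).trans (ff1_bound y 1 one_mem)
  have hsub : uIcc 1 r ⊆ Icc (1/2:ℝ) 2 := (convex_Icc _ _).ordConnected.uIcc_subset one_mem hr
  have hpos : ∀ t ∈ uIcc 1 r, 0 < t := fun t ht => by linarith [(hsub ht).1]
  have hc : Convex ℝ (uIcc 1 r) := convex_uIcc _ _
  have key := hc.norm_image_sub_le_of_norm_hasDerivWithin_le
    (f := fun t => ff y t - ff1 y 1 * t) (f' := fun t => ff1 y t - ff1 y 1 * 1)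
    (C := MM y * |r - 1|) (x := 1) (y := r)
    (fun t ht => ((ff_deriv y t (hpos t ht)).sub
      ((hasDerivAt_id t).const_mul (ff1 y 1))).hasDerivWithinAt) ?_ left_mem_uIcc right_mem_uIcc
  · rw [Real.norm_eq_abs, Real.norm_eq_abs] at key
    calc _ = |ff y r - ff1 y 1 * r - (ff y 1 - ff1 y 1 * 1)| := by congr 1; ring
      _ ≤ _ := key
      _ = _ := by rw [mul_assoc, abs_mul_abs_self]; ring
  · intro t ht
    have k2 := hc.norm_image_sub_le_of_norm_hasDerivWithin_le
      (f := ff1 y) (f' := ff2 y) (C := MM y) (x := 1) (y := t)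
      (fun s hs => (ff1_deriv y s (hpos s hs)).hasDerivWithinAt)
      (fun s hs => ff2_bound y s (hsub hs)) left_mem_uIcc ht
    rw [mul_one]
    refine k2.trans ?_
    gcongr
    have := abs_sub_left_of_mem_uIcc ht
    simpa [Real.norm_eq_abs] using this

lemma MM_integrable : Integrable MM := by
  have h0 := integrable_exp_neg_mul_sq (b := 1/4) (by norm_num)
  have h2 := integrable_rpow_mul_exp_neg_mul_sq (b := 1/4) (by norm_num) (s := 2) (by norm_num)
  have h4 := integrable_rpow_mul_exp_neg_mul_sq (b := 1/4) (by norm_num) (s := 4) (by norm_num)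
  refine (((h0.const_mul 6).add (h2.const_mul 24)).add (h4.const_mul 8)).congr ?_
  refine Filter.Eventually.of_forall fun y => ?_
  have e2 : y ^ (2:ℝ) = y^2 := by exact_mod_cast Real.rpow_natCast y 2
  have e4 : y ^ (4:ℝ) = y^4 := by exact_mod_cast Real.rpow_natCast y 4
  simp only [MM, Pi.add_apply, e2, e4]
  ring

lemma ff_eq (y r : ℝ) (hr : 0 < r) : gaussianPDFReal 0 r.toNNReal y = ff y r := by
  rw [gaussianPDFReal, ff, hh, Real.coe_toNNReal _ hr.le, Real.exp_sub, Real.sqrt_mul (by positivity)]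
  have : Real.exp (-(1/2) * Real.log r) = (Real.sqrt r)⁻¹ := by
    rw [← Real.exp_log (Real.sqrt_pos.2 hr), ← Real.exp_neg, Real.log_sqrt hr.le]
    congr 1; ring
  rw [this, div_eq_mul_inv (Real.sqrt r)⁻¹, ← Real.exp_neg, sub_zero, mul_inv, neg_div, mul_assoc]

lemma int01 {E : Type*} [MeasurableSpace E] (P : Measure E) [IsProbabilityMeasure P]
    (φ : E → ℝ) (hφ : Measurable φ) (h : ∀ x, 0 ≤ φ x ∧ φ x ≤ 1) : Integrable φ P :=
  Integrable.of_bound hφ.aestronglyMeasurable 1 (Filter.Eventually.of_forall fun x => by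
    rw [Real.norm_eq_abs, abs_of_nonneg (h x).1]; exact (h x).2)

lemma int01_mem {E : Type*} [MeasurableSpace E] (P : Measure E) [IsProbabilityMeasure P]
    (φ : E → ℝ) (hφ : Measurable φ) (h : ∀ x, 0 ≤ φ x ∧ φ x ≤ 1) :
    0 ≤ ∫ x, φ x ∂P ∧ ∫ x, φ x ∂P ≤ 1 := by
  refine ⟨integral_nonneg fun x => (h x).1, ?_⟩
  have := integral_mono (int01 P φ hφ h) (integrable_const (1:ℝ)) (fun x => (h x).2)
  simpa using this

lemma key_taylor : ∃ K : ℝ, 0 < K ∧ ∀ φ : ℝ → ℝ, Measurable φ → (∀ x, 0 ≤ φ x ∧ φ x ≤ 1) →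
    ∃ c : ℝ, ∀ r : ℝ, 0 ≤ r →
      |∫ x, φ x ∂(gaussianReal 0 r.toNNReal) - ∫ x, φ x ∂(gaussianReal 0 1) - c * (r - 1)|
        ≤ K * (r-1)^2 := by
  have one_mem : (1:ℝ) ∈ Icc (1/2:ℝ) 2 := by constructor <;> norm_num
  set K0 := ∫ y, MM y with hK0
  have hMnn : ∀ y, 0 ≤ MM y := fun y => (abs_nonneg _).trans (ff1_bound y 1 one_mem)
  have hK0nn : 0 ≤ K0 := integral_nonneg hMnn
  refine ⟨4 + 2 * K0, by positivity, fun φ hφ h01 => ?_⟩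
  have hφM : ∀ r : ℝ, r ∈ Icc (1/2:ℝ) 2 → Integrable (fun y => ff y r * φ y) := by
    intro r hr
    have hr0 : 0 < r := by linarith [hr.1]
    have := (integrable_gaussianPDFReal 0 r.toNNReal).mul_bdd (c := 1) (g := φ) hφ.aestronglyMeasurable
      (Filter.Eventually.of_forall fun x => by
        rw [Real.norm_eq_abs, abs_of_nonneg (h01 x).1]; exact (h01 x).2)
    refine this.congr (Filter.Eventually.of_forall fun y => ?_)
    simp only [ff_eq y r hr0]
  have hrep : ∀ r : ℝ, r ∈ Icc (1/2:ℝ) 2 →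
      ∫ x, φ x ∂(gaussianReal 0 r.toNNReal) = ∫ y, ff y r * φ y := by
    intro r hr
    have hr0 : 0 < r := by linarith [hr.1]
    rw [integral_gaussianReal_eq_integral_smul (by simpa using hr0)]
    simp only [smul_eq_mul, ff_eq _ r hr0]
  have hm1 : Measurable (fun y => ff1 y 1) := by
    unfold ff1 ff hh hh1; fun_prop
  have hi1 : Integrable (fun y => ff1 y 1) :=
    MM_integrable.mono' hm1.aestronglyMeasurable
      (Filter.Eventually.of_forall fun y => ff1_bound y 1 one_mem)
  have hi1φ : Integrable (fun y => ff1 y 1 * φ y) :=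
    hi1.mul_bdd (c := 1) hφ.aestronglyMeasurable
      (Filter.Eventually.of_forall fun x => by
        rw [Real.norm_eq_abs, abs_of_nonneg (h01 x).1]; exact (h01 x).2)
  refine ⟨∫ y, ff1 y 1 * φ y, fun r hr => ?_⟩
  set c := ∫ y, ff1 y 1 * φ y with hc
  have hφabs : ∀ y (t : ℝ), |t * φ y| ≤ |t| := fun y t => by
    rw [abs_mul, abs_of_nonneg (h01 y).1]
    exact mul_le_of_le_one_right (abs_nonneg _) (h01 y).2
  have hcb : |c| ≤ K0 := by
    rw [← Real.norm_eq_abs]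
    refine norm_integral_le_of_norm_le MM_integrable (Filter.Eventually.of_forall fun y => ?_)
    exact (hφabs y _).trans (ff1_bound y 1 one_mem)
  by_cases hmem : r ∈ Icc (1/2:ℝ) 2
  · have e1 := hrep 1 one_mem
    rw [Real.toNNReal_one] at e1
    rw [hrep r hmem, e1, ← integral_sub (hφM r hmem) (hφM 1 one_mem), hc, ← integral_mul_const]
    have e2 := integral_sub ((hφM r hmem).sub (hφM 1 one_mem)) (hi1φ.mul_const (r-1))
    simp only [Pi.sub_apply] at e2
    rw [← e2]
    rw [← Real.norm_eq_abs]
    have : ‖∫ y, ff y r * φ y - ff y 1 * φ y - ff1 y 1 * φ y * (r-1)‖ ≤ ∫ y, MM y * (r-1)^2 := by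
      refine norm_integral_le_of_norm_le (MM_integrable.mul_const _)
        (Filter.Eventually.of_forall fun y => ?_)
      refine le_trans ?_ (ff_taylor y r hmem)
      refine le_trans (le_of_eq ?_) (hφabs y _)
      rw [Real.norm_eq_abs]; congr 1; ring
    refine this.trans ?_
    rw [integral_mul_const]
    nlinarith [sq_nonneg (r-1)]
  · have hfar : 1/2 ≤ |r - 1| := by
      by_contra hlt
      push Not at hlt
      rw [abs_lt] at hlt
      exact hmem ⟨by linarith, by linarith⟩
    have m1 := int01_mem (gaussianReal 0 r.toNNReal) φ hφ h01
    have m2 := int01_mem (gaussianReal 0 1) φ hφ h01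
    have hd : |∫ x, φ x ∂(gaussianReal 0 r.toNNReal) - ∫ x, φ x ∂(gaussianReal 0 1)| ≤ 1 := by
      rw [abs_le]; constructor <;> linarith [m1.1, m1.2, m2.1, m2.2]
    refine (abs_sub _ _).trans ?_
    rw [abs_mul]
    have : |c| * |r-1| ≤ K0 * |r-1| := by gcongr
    have h2 : (r-1)^2 = |r-1|^2 := (sq_abs _).symm
    rw [h2]
    nlinarith [mul_nonneg hK0nn (mul_nonneg (abs_nonneg (r-1)) (by linarith : 0 ≤ |r-1| - 1/2))]

lemma gauss_lin (d : ℕ) (v : NNReal) (c : Fin d → ℝ) :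
    Measure.map (fun z : Fin d → ℝ => ∑ j, c j * z j) (Measure.pi fun _ : Fin d => gaussianReal 0 v)
      = gaussianReal 0 ((∑ j, c j ^ 2) * v).toNNReal := by
  have hm : Measurable (fun z : Fin d → ℝ => ∑ j, c j * z j) := by fun_prop
  have : IsProbabilityMeasure (Measure.map (fun z : Fin d → ℝ => ∑ j, c j * z j)
    (Measure.pi fun _ : Fin d => gaussianReal 0 v)) :=
    Measure.isProbabilityMeasure_map hm.aemeasurable
  apply Measure.ext_of_charFun
  ext t
  rw [charFun_apply_real, integral_map hm.aemeasurable (by fun_prop), charFun_gaussianReal]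
  have e : ∀ z : Fin d → ℝ, Complex.exp (t * ((∑ j, c j * z j : ℝ) : ℂ) * Complex.I)
      = ∏ j, Complex.exp ((t * c j : ℝ) * (z j : ℂ) * Complex.I) := by
    intro z
    rw [← Complex.exp_sum]
    congr 1
    push_cast
    rw [Finset.mul_sum, Finset.sum_mul]
    exact Finset.sum_congr rfl fun j _ => by ring
  simp_rw [e]
  rw [integral_fintype_prod_eq_prod
    (f := fun j (x : ℝ) => Complex.exp ((t * c j : ℝ) * (x : ℂ) * Complex.I))]
  simp_rw [← charFun_apply_real, charFun_gaussianReal]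
  rw [← Complex.exp_sum]
  congr 1
  rw [Real.coe_toNNReal _ (by positivity)]
  push_cast
  simp only [mul_zero, zero_mul, zero_sub]
  rw [Finset.sum_mul, Finset.sum_mul, Finset.sum_div, ← Finset.sum_neg_distrib]
  exact Finset.sum_congr rfl fun j _ => by ring

lemma sq_memLp : MemLp (fun x : ℝ => x^2) 2 (gaussianReal 0 1) := by
  have h4 := memLp_id_gaussianReal (μ := 0) (v := 1) 4
  rw [memLp_two_iff_integrable_sq (by fun_prop)]
  have := h4.integrable_norm_pow (p := 4) (by norm_num)
  refine this.congr (Filter.Eventually.of_forall fun x => ?_)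
  simp only [id, Real.norm_eq_abs]
  rw [← pow_mul, show 2*2 = 4 by norm_num, Even.pow_abs (by decide)]

lemma id_memLp : MemLp (fun x : ℝ => x) 2 (gaussianReal 0 1) :=
  memLp_id_gaussianReal (μ := 0) (v := 1) 2

lemma one_memLp (σ u : ℝ) : MemLp (fun x : ℝ => (σ * x + u)^2) 2 (gaussianReal 0 1) := by
  have := ((sq_memLp.const_mul (σ^2)).add (id_memLp.const_mul (2*σ*u))).add (memLp_const (u^2))
  refine this.ae_eq (Filter.Eventually.of_forall fun x => ?_)
  simp only [Pi.add_apply]; ring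

lemma int_sq : ∫ x : ℝ, x^2 ∂(gaussianReal 0 1) = 1 := by
  have h1 := variance_fun_id_gaussianReal (μ := 0) (v := 1)
  rw [variance_eq_integral (by fun_prop)] at h1
  simpa using h1

lemma one_mean (σ u : ℝ) : ∫ x : ℝ, (σ * x + u)^2 ∂(gaussianReal 0 1) = σ^2 + u^2 := by
  have i2 : Integrable (fun x : ℝ => x^2) (gaussianReal 0 1) := sq_memLp.integrable (by norm_num)
  have i1 : Integrable (fun x : ℝ => x) (gaussianReal 0 1) := id_memLp.integrable (by norm_num)
  have e : ∀ x : ℝ, (σ * x + u)^2 = σ^2 * x^2 + (2*σ*u) * x + u^2 := fun x => by ring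
  simp_rw [e]
  have a := integral_add ((i2.const_mul (σ^2)).add (i1.const_mul (2*σ*u))) (integrable_const (u^2))
  simp only [Pi.add_apply] at a
  rw [a,
    integral_add (i2.const_mul _) (i1.const_mul _), integral_const_mul, integral_const_mul,
    int_sq, integral_id_gaussianReal]
  simp

lemma one_var (σ u : ℝ) : Var[fun x : ℝ => (σ * x + u)^2; gaussianReal 0 1] ≤
    2 * σ^4 * Var[fun x : ℝ => x^2; gaussianReal 0 1] + 8 * σ^2 * u^2 := by
  have i2 : Integrable (fun x : ℝ => x^2) (gaussianReal 0 1) := sq_memLp.integrable (by norm_num)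
  have hvar := sq_memLp
  rw [variance_eq_integral (by fun_prop), variance_eq_integral (by fun_prop), one_mean, int_sq]
  have hc : MemLp (fun x : ℝ => x^2 - 1) 2 (gaussianReal 0 1) := sq_memLp.sub (memLp_const 1)
  have ic := hc.integrable_sq
  have e2 : (8 * σ^2 * u^2 : ℝ) = 8 * σ^2 * u^2 * ∫ x : ℝ, x^2 ∂(gaussianReal 0 1) := by
    rw [int_sq]; ring
  rw [e2, ← integral_const_mul, ← integral_const_mul,
    ← integral_add (ic.const_mul _) (i2.const_mul _)]
  refine integral_mono ?_ ((ic.const_mul _).add (i2.const_mul _)) fun x => ?_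
  · exact ((one_memLp σ u).sub (memLp_const (σ^2+u^2))).integrable_sq
  · simp only
    nlinarith [sq_nonneg (σ^2*(x^2-1) - 2*σ*u*x)]

lemma moments (d : ℕ) (hd : 1 ≤ d) (σ : ℝ) (hσ : 0 < σ) (u : Fin d → ℝ) (S : ℝ)
    (hS : S = d * σ^2 + ∑ j, u j ^2) :
    MemLp (fun n : Fin d → ℝ => (∑ j, (σ * n j + u j)^2) / S) 2
      (Measure.pi fun _ : Fin d => gaussianReal 0 1) ∧
    ∫ n : Fin d → ℝ, (∑ j, (σ * n j + u j)^2) / S ∂(Measure.pi fun _ : Fin d => gaussianReal 0 1)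
      = 1 ∧
    ∫ n : Fin d → ℝ, ((∑ j, (σ * n j + u j)^2) / S - 1)^2
      ∂(Measure.pi fun _ : Fin d => gaussianReal 0 1)
      ≤ (2 * Var[fun x : ℝ => x^2; gaussianReal 0 1] + 8) / d := by
  have hd0 : (0:ℝ) < d := by exact_mod_cast hd
  have hu : 0 ≤ ∑ j, u j ^2 := Finset.sum_nonneg fun j _ => sq_nonneg _
  have hdS : d * σ^2 ≤ S := by linarith
  have hS0 : 0 < S := lt_of_lt_of_le (by positivity) hdS
  have hm0 : 0 ≤ Var[fun x : ℝ => x^2; gaussianReal 0 1] := variance_nonneg _ _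
  have hmp : ∀ j, MeasurePreserving (Function.eval j)
    (Measure.pi fun _ : Fin d => gaussianReal 0 1) (gaussianReal 0 1) :=
    fun j => measurePreserving_eval (fun _ : Fin d => gaussianReal 0 1) j
  have hML : ∀ j, MemLp (fun n : Fin d → ℝ => (σ * n j + u j)^2) 2
      (Measure.pi fun _ : Fin d => gaussianReal 0 1) := fun j =>
    (one_memLp σ (u j)).comp_measurePreserving (hmp j)
  have hsum : MemLp (fun n : Fin d → ℝ => ∑ j, (σ * n j + u j)^2) 2
      (Measure.pi fun _ : Fin d => gaussianReal 0 1) := memLp_finsetSum _ fun j _ => hML j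
  have hmean : ∫ n : Fin d → ℝ, ∑ j, (σ * n j + u j)^2
      ∂(Measure.pi fun _ : Fin d => gaussianReal 0 1) = S := by
    rw [integral_finsetSum _ fun j _ => (hML j).integrable (by norm_num), hS]
    have : ∀ j, ∫ n : Fin d → ℝ, (σ * n j + u j)^2
      ∂(Measure.pi fun _ : Fin d => gaussianReal 0 1) = σ^2 + u j ^2 := by
      intro j
      have a := integral_map (μ := Measure.pi fun _ : Fin d => gaussianReal 0 1)
        (hmp j).measurable.aemeasurable (f := fun x : ℝ => (σ * x + u j)^2) (by fun_prop)
      rw [(hmp j).map_eq, one_mean] at a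
      exact a.symm
    simp_rw [this]
    rw [Finset.sum_add_distrib]; simp
  have hvar : Var[fun n : Fin d → ℝ => ∑ j, (σ * n j + u j)^2;
      Measure.pi fun _ : Fin d => gaussianReal 0 1] ≤
      (2 * Var[fun x : ℝ => x^2; gaussianReal 0 1] + 8) * σ^2 * S := by
    have e := variance_sum_pi (μ := fun _ : Fin d => gaussianReal 0 1)
      (X := fun j x => (σ * x + u j)^2) (fun j => one_memLp σ (u j))
    have e' : (∑ i, fun ω : Fin d → ℝ => (σ * ω i + u i)^2) = fun n => ∑ j, (σ * n j + u j)^2 := by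
      ext n; simp
    rw [e'] at e
    rw [e]
    refine (Finset.sum_le_sum fun j _ => one_var σ (u j)).trans ?_
    rw [Finset.sum_add_distrib, ← Finset.mul_sum Finset.univ (fun j => u j ^ 2), hS]
    simp only [Finset.sum_const, Finset.card_univ, Fintype.card_fin, nsmul_eq_mul]
    nlinarith [mul_nonneg hm0 (mul_nonneg (sq_nonneg σ) hu), mul_nonneg hd0.le (sq_nonneg (σ^2))]
  refine ⟨?_, ?_, ?_⟩
  · simpa [div_eq_mul_inv] using hsum.mul_const S⁻¹
  · rw [integral_div, hmean, div_self hS0.ne']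
  · rw [variance_eq_integral hsum.aestronglyMeasurable.aemeasurable, hmean] at hvar
    have e : ∀ n : Fin d → ℝ, ((∑ j, (σ * n j + u j)^2) / S - 1)^2
        = ((∑ j, (σ * n j + u j)^2) - S)^2 / S^2 := by
      intro n; field_simp
    simp_rw [e]
    rw [integral_div, div_le_div_iff₀ (by positivity) hd0]
    calc _ ≤ ((2 * Var[fun x : ℝ => x^2; gaussianReal 0 1] + 8) * σ^2 * S) * d := by gcongr
      _ = (2 * Var[fun x : ℝ => x^2; gaussianReal 0 1] + 8) * S * (d * σ^2) := by ring
      _ ≤ (2 * Var[fun x : ℝ => x^2; gaussianReal 0 1] + 8) * S * S := by gcongr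
      _ = _ := by ring

lemma approx : ∃ C : ℝ, 0 < C ∧ ∀ d : ℕ, 1 ≤ d → ∀ σθ σz : ℝ, 0 < σθ → 0 < σz →
    ∀ u : Fin d → ℝ, ∀ φ : ℝ → ℝ, Measurable φ → (∀ x, 0 ≤ φ x ∧ φ x ≤ 1) →
    |∫ x, φ x ∂(scalarProductLaw d σθ σz u) -
      ∫ x, φ (σz * (Real.sqrt ((d : ℝ) * σθ ^ 2 + vnorm u ^ 2) * x)) ∂(gaussianReal 0 1)| ≤ C / d := by
  obtain ⟨K, hK, hT⟩ := key_taylor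
  have hm0 : 0 ≤ Var[fun x : ℝ => x^2; gaussianReal 0 1] := variance_nonneg _ _
  refine ⟨K * (2 * Var[fun x : ℝ => x^2; gaussianReal 0 1] + 8), by positivity, ?_⟩
  intro d hd σθ σz hσθ hσz u φ hφ h01
  have hd0 : (0:ℝ) < d := by exact_mod_cast hd
  have hu : 0 ≤ ∑ j, u j ^2 := Finset.sum_nonneg fun j _ => sq_nonneg _
  have hvn : vnorm u ^ 2 = ∑ j, u j ^2 := Real.sq_sqrt hu
  rw [hvn]
  set S := (d : ℝ) * σθ ^ 2 + ∑ j, u j ^2 with hS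
  have hS0 : 0 < S := by positivity
  obtain ⟨hR2, hR1, hRv⟩ := moments d hd σθ hσθ u S hS
  set P := (Measure.pi fun _ : Fin d => gaussianReal 0 1) with hP
  set R : (Fin d → ℝ) → ℝ := fun n => (∑ j, (σθ * n j + u j)^2) / S with hRdef
  have hRnn : ∀ n, 0 ≤ R n := fun n => by
    apply div_nonneg (Finset.sum_nonneg fun j _ => sq_nonneg _) hS0.le
  set ψ : ℝ → ℝ := fun x => φ (σz * (Real.sqrt S * x)) with hψ
  have hψm : Measurable ψ := by
    apply hφ.comp; fun_prop
  obtain ⟨c, hc⟩ := hT ψ hψm (fun x => h01 _)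
  -- the law
  have hmeas : Measurable
    (fun ω : (Fin d → ℝ) × (Fin d → ℝ) => ∑ j, (σθ * ω.1 j + u j) * ω.2 j) := by fun_prop
  have hint : Integrable (fun ω : (Fin d → ℝ) × (Fin d → ℝ) =>
      φ (∑ j, (σθ * ω.1 j + u j) * ω.2 j)) (P.prod
        (Measure.pi fun _ : Fin d => gaussianReal 0 (σz ^ 2).toNNReal)) :=
    int01 _ _ (hφ.comp hmeas) (fun x => h01 _)
  have hinner : ∀ n : Fin d → ℝ, ∫ z, φ (∑ j, (σθ * n j + u j) * z j)
      ∂(Measure.pi fun _ : Fin d => gaussianReal 0 (σz ^ 2).toNNReal)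
      = ∫ x, ψ x ∂(gaussianReal 0 (R n).toNNReal) := by
    intro n
    have hm : Measurable (fun z : Fin d → ℝ => ∑ j, (σθ * n j + u j) * z j) := by fun_prop
    rw [← integral_map (μ := Measure.pi fun _ : Fin d => gaussianReal 0 (σz ^ 2).toNNReal)
      hm.aemeasurable (f := φ) hφ.aestronglyMeasurable, gauss_lin]
    have hm2 : Measurable (fun x : ℝ => (σz * Real.sqrt S) * x) := by fun_prop
    have e : ψ = fun x => φ ((σz * Real.sqrt S) * x) := by ext x; simp only [hψ]; rw [mul_assoc]
    rw [e, ← integral_map (μ := gaussianReal 0 (R n).toNNReal) hm2.aemeasurable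
      (f := φ) hφ.aestronglyMeasurable, gaussianReal_map_const_mul, mul_zero]
    congr 2
    ext
    have h1 : 0 ≤ ∑ j, (σθ * n j + u j)^2 := Finset.sum_nonneg fun j _ => sq_nonneg _
    rw [Real.coe_toNNReal _ (by positivity), NNReal.coe_mul, Real.coe_toNNReal _ (hRnn n),
      Real.coe_toNNReal _ (by positivity)]
    simp only [hRdef, NNReal.coe_mk, mul_pow, Real.sq_sqrt hS0.le]
    field_simp
  have hlaw : ∫ x, φ x ∂(scalarProductLaw d σθ σz u)
      = ∫ n, ∫ x, ψ x ∂(gaussianReal 0 (R n).toNNReal) ∂P := by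
    unfold scalarProductLaw
    rw [integral_map hmeas.aemeasurable hφ.aestronglyMeasurable, integral_prod _ hint]
    exact integral_congr_ae (Filter.Eventually.of_forall hinner)
  have hgi : Integrable (fun n => ∫ x, ψ x ∂(gaussianReal 0 (R n).toNNReal)) P := by
    refine hint.integral_prod_left.congr (Filter.Eventually.of_forall hinner)
  have hRi : Integrable R P := hR2.integrable (by norm_num)
  have hR1i : Integrable (fun n => c * (R n - 1)) P := (hRi.sub (integrable_const 1)).const_mul c
  have hsq : Integrable (fun n => K * (R n - 1)^2) P :=
    ((hR2.sub (memLp_const 1)).integrable_sq).const_mul K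
  have hzero : ∫ n, c * (R n - 1) ∂P = 0 := by
    rw [integral_const_mul, integral_sub hRi (integrable_const 1), hR1]; simp
  have heq : ∫ x, φ x ∂(scalarProductLaw d σθ σz u) - ∫ x, ψ x ∂(gaussianReal 0 1)
      = ∫ n, (∫ x, ψ x ∂(gaussianReal 0 (R n).toNNReal) - ∫ x, ψ x ∂(gaussianReal 0 1)
          - c * (R n - 1)) ∂P := by
    have a := integral_sub (hgi.sub (integrable_const (∫ x, ψ x ∂(gaussianReal 0 1)))) hR1i
    have b := integral_sub hgi (integrable_const (μ := P) (∫ x, ψ x ∂(gaussianReal 0 1)))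
    simp only [Pi.sub_apply] at a
    rw [a, b, hzero, hlaw]; simp
  rw [heq, ← Real.norm_eq_abs]
  refine (norm_integral_le_of_norm_le hsq (Filter.Eventually.of_forall fun n => hc _ (hRnn n))).trans ?_
  rw [integral_const_mul, mul_div_assoc]
  gcongr

instance : NullSingletonClass (gaussianReal 0 1) := nullSingletonClass_gaussianReal one_ne_zero

lemma Φ_eq : Φ = fun x => (gaussianReal 0 1).real (Iic x) := rfl

lemma Φ_mono : Monotone Φ := fun x y h => by
  rw [Φ_eq]; exact measureReal_mono (Iic_subset_Iic.2 h)

lemma Φ_neg (t : ℝ) : Φ (-t) = 1 - Φ t := by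
  rw [Φ_eq]
  simp only
  rw [← probReal_compl_eq_one_sub measurableSet_Iic, compl_Iic]
  have h : (gaussianReal 0 1).map (fun x => -x) = gaussianReal 0 1 := by
    rw [gaussianReal_map_neg, neg_zero]
  have e : (gaussianReal 0 1).real (Iic (-t)) = (gaussianReal 0 1).real (Ici t) := by
    conv_lhs => rw [← h]
    rw [map_measureReal_apply (by fun_prop) measurableSet_Iic]
    congr 1; ext x; simp
  rw [e]
  exact measureReal_congr Ioi_ae_eq_Ici.symm

lemma Φ_zero : Φ 0 = 1/2 := by
  have := Φ_neg 0
  rw [neg_zero] at this; linarith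

lemma Φ_cont : Continuous Φ := by
  have h : Φ = cdf (gaussianReal 0 1) := by
    ext x; rw [cdf_eq_real]; rfl
  have hc : ∀ x, ContinuousAt (cdf (gaussianReal 0 1)) x := by
    intro x
    rw [(cdf (gaussianReal 0 1)).mono.continuousAt_iff_leftLim_eq_rightLim, StieltjesFunction.rightLim_eq]
    have h1 := (cdf (gaussianReal 0 1)).measure_singleton x
    rw [measure_cdf, measure_singleton] at h1
    have h2 := (cdf (gaussianReal 0 1)).mono.leftLim_le (le_refl x)
    have h3 := ENNReal.ofReal_eq_zero.1 h1.symm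
    linarith
  rw [h]; exact continuous_iff_continuousAt.2 hc

lemma Φ_inv (p : ℝ) (h0 : 0 < p) (h1 : p < 1) : Φ (Φinv p) = p := by
  have h : Φ = cdf (gaussianReal 0 1) := by
    ext x; rw [cdf_eq_real]; rfl
  have hb := tendsto_cdf_atBot (gaussianReal 0 1)
  have ht := tendsto_cdf_atTop (gaussianReal 0 1)
  rw [← h] at hb ht
  obtain ⟨x, hx⟩ := (hb.eventually_le_const h0).exists
  obtain ⟨y, hy⟩ := (ht.eventually_const_le h1).exists
  exact Function.invFun_eq (mem_range_of_exists_le_of_exists_ge Φ_cont ⟨x, hx⟩ ⟨y, hy⟩)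

lemma Φ_inv_pos (p : ℝ) (h0 : 1/2 < p) (h1 : p < 1) : 0 < Φinv p := by
  by_contra h
  have := Φ_mono (not_lt.1 h)
  rw [Φ_zero, Φ_inv p (by linarith) h1] at this
  linarith

def ind (t x : ℝ) : ℝ := if |x| ≤ t then 1 else 0

lemma ind_meas (t : ℝ) : Measurable (ind t) :=
  Measurable.ite (measurableSet_le (by fun_prop) (by fun_prop)) (by fun_prop) (by fun_prop)

lemma ind01 (t x : ℝ) : 0 ≤ ind t x ∧ ind t x ≤ 1 := by
  unfold ind; split_ifs <;> norm_num

lemma ind_scale (t s x : ℝ) (hs : 0 < s) : ind t (s * x) = ind (t/s) x := by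
  unfold ind
  have : |s * x| ≤ t ↔ |x| ≤ t / s := by
    rw [abs_mul, abs_of_pos hs, le_div_iff₀ hs, mul_comm]
  simp only [this]

lemma ind_int (t : ℝ) (ht : 0 ≤ t) : ∫ x, ind t x ∂(gaussianReal 0 1) = 2 * Φ t - 1 := by
  have e : ind t = (Icc (-t) t).indicator (fun _ => (1:ℝ)) := by
    ext x; simp only [ind, indicator, mem_Icc, abs_le]
  rw [e, integral_indicator_const _ measurableSet_Icc]
  have h2 : Icc (-t) t =ᵐ[gaussianReal 0 1] Ioc (-t) t := Ioc_ae_eq_Icc.symm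
  rw [measureReal_congr h2, ← Iic_sdiff_Iic, measureReal_sdiff (Iic_subset_Iic.2 (by linarith)) measurableSet_Iic]
  have := Φ_neg t
  rw [Φ_eq] at *
  simp only at *
  rw [this]; simp; ring

lemma toPDF (σ : ℝ) (hσ : 0 < σ) (φ : ℝ → ℝ) (hφ : Measurable φ) :
    ∫ x, φ (σ * x) ∂(gaussianReal 0 1) = ∫ x, gaussianPDFReal 0 (σ^2).toNNReal x * φ x := by
  have hm : Measurable (fun x : ℝ => σ * x) := by fun_prop
  rw [← integral_map (μ := gaussianReal 0 1) hm.aemeasurable (f := φ) hφ.aestronglyMeasurable,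
    gaussianReal_map_const_mul, mul_zero, mul_one]
  have : NNReal.mk (σ^2) (sq_nonneg σ) = (σ^2).toNNReal := by
    apply NNReal.eq; rw [Real.coe_toNNReal _ (sq_nonneg σ)]; rfl
  rw [this, integral_gaussianReal_eq_integral_smul (by simpa using hσ.ne')]
  rfl

lemma pdf_cmp (s1 s2 t x : ℝ) (h1 : 0 < s1) (h2 : 0 < s2)
    (h : 0 ≤ (1/(2*s1^2) - 1/(2*s2^2)) * (x^2 - t^2)) :
    gaussianPDFReal 0 (s2^2).toNNReal t * gaussianPDFReal 0 (s1^2).toNNReal x ≤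
    gaussianPDFReal 0 (s2^2).toNNReal x * gaussianPDFReal 0 (s1^2).toNNReal t := by
  simp only [gaussianPDFReal, Real.coe_toNNReal _ (sq_nonneg _), sub_zero]
  rw [mul_mul_mul_comm, mul_mul_mul_comm _ _ (Real.sqrt (2 * Real.pi * s1^2))⁻¹, ← Real.exp_add, ← Real.exp_add]
  refine mul_le_mul_of_nonneg_left (Real.exp_le_exp.2 ?_) (by positivity)
  have e : ∀ z s : ℝ, -z^2 / (2*s^2) = - ((1/(2*s^2)) * z^2) := fun z s => by ring
  rw [e, e, e, e]
  linarith

lemma NP_gen (s1 s2 t : ℝ) (h1 : 0 < s1) (h2 : 0 < s2) (ψ φ : ℝ → ℝ)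
    (hψ : Measurable ψ) (h01 : ∀ x, 0 ≤ ψ x ∧ ψ x ≤ 1)
    (hφ : Measurable φ) (h01' : ∀ x, 0 ≤ φ x ∧ φ x ≤ 1)
    (hin : ∀ x, 0 ≤ (1/(2*s1^2) - 1/(2*s2^2)) * (x^2 - t^2) ∨ ψ x = 0)
    (hout : ∀ x, (1/(2*s1^2) - 1/(2*s2^2)) * (x^2 - t^2) ≤ 0 ∨ ψ x = 1)
    (hle : ∫ x, φ (s1 * x) ∂(gaussianReal 0 1) ≤ ∫ x, ψ (s1 * x) ∂(gaussianReal 0 1)) :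
    ∫ x, φ (s2 * x) ∂(gaussianReal 0 1) ≤ ∫ x, ψ (s2 * x) ∂(gaussianReal 0 1) := by
  rw [toPDF s1 h1 φ hφ, toPDF s1 h1 ψ hψ] at hle
  rw [toPDF s2 h2 φ hφ, toPDF s2 h2 ψ hψ]
  have hI : ∀ (s : ℝ) (χ : ℝ → ℝ), Measurable χ → (∀ x, 0 ≤ χ x ∧ χ x ≤ 1) →
      Integrable (fun x => gaussianPDFReal 0 (s^2).toNNReal x * χ x) := fun s χ hm hb =>
    (integrable_gaussianPDFReal 0 _).mul_bdd (c := 1) hm.aestronglyMeasurable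
      (Filter.Eventually.of_forall fun x => by
        rw [Real.norm_eq_abs, abs_of_nonneg (hb x).1]; exact (hb x).2)
  set p := gaussianPDFReal 0 (s1^2).toNNReal with hp
  set q := gaussianPDFReal 0 (s2^2).toNNReal with hq
  have hpt : 0 < p t := gaussianPDFReal_pos _ _ _ (by simpa using h1.ne')
  have hqt : 0 < q t := gaussianPDFReal_pos _ _ _ (by simpa using h2.ne')
  have hpw : ∀ x, q t * (p x * ψ x - p x * φ x) ≤ p t * (q x * ψ x - q x * φ x) := by
    intro x
    suffices 0 ≤ (ψ x - φ x) * (q x * p t - q t * p x) by nlinarith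
    have hlo : (1/(2*s1^2) - 1/(2*s2^2)) * (x^2 - t^2) ≤ 0 → q x * p t ≤ q t * p x := by
      intro h
      exact pdf_cmp s1 s2 x t h1 h2 (by linarith)
    rcases hin x with h | h
    · have c1 := pdf_cmp s1 s2 t x h1 h2 h
      rcases hout x with h' | h'
      · have := hlo h'
        have : q x * p t - q t * p x = 0 := by linarith
        rw [this]; simp
      · apply mul_nonneg
        · linarith [(h01' x).2]
        · linarith
    · rcases hout x with h' | h'
      · have := hlo h'
        apply mul_nonneg_of_nonpos_of_nonpos
        · linarith [(h01' x).1]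
        · linarith
      · linarith
  have := integral_mono (((hI s1 ψ hψ h01).sub (hI s1 φ hφ h01')).const_mul (q t))
    (((hI s2 ψ hψ h01).sub (hI s2 φ hφ h01')).const_mul (p t)) hpw
  simp only [Pi.sub_apply] at this
  rw [integral_const_mul, integral_const_mul, integral_sub (hI s1 ψ hψ h01) (hI s1 φ hφ h01'),
    integral_sub (hI s2 ψ hψ h01) (hI s2 φ hφ h01')] at this
  have h3 : 0 ≤ p t * ((∫ x, q x * ψ x) - (∫ x, q x * φ x)) :=
    le_trans (mul_nonneg hqt.le (by linarith)) this
  have := nonneg_of_mul_nonneg_right h3 hpt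
  linarith

lemma NP (s1 s2 a : ℝ) (h1 : 0 < s1) (h2 : 0 < s2) (ha0 : 0 < a) (ha1 : a < 1) :
    ∃ ψ : ℝ → ℝ, Measurable ψ ∧ (∀ x, 0 ≤ ψ x ∧ ψ x ≤ 1) ∧
      ∫ x, ψ (s1 * x) ∂(gaussianReal 0 1) = a ∧
      1 - ∫ x, ψ (s2 * x) ∂(gaussianReal 0 1) = Gtilde s1 s2 a ∧
      ∀ φ : ℝ → ℝ, Measurable φ → (∀ x, 0 ≤ φ x ∧ φ x ≤ 1) →
        ∫ x, φ (s1 * x) ∂(gaussianReal 0 1) ≤ a →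
        Gtilde s1 s2 a ≤ 1 - ∫ x, φ (s2 * x) ∂(gaussianReal 0 1) := by
  have main : ∃ (ψ : ℝ → ℝ) (t : ℝ), Measurable ψ ∧ (∀ x, 0 ≤ ψ x ∧ ψ x ≤ 1) ∧
      ∫ x, ψ (s1 * x) ∂(gaussianReal 0 1) = a ∧
      1 - ∫ x, ψ (s2 * x) ∂(gaussianReal 0 1) = Gtilde s1 s2 a ∧
      (∀ x, 0 ≤ (1/(2*s1^2) - 1/(2*s2^2)) * (x^2 - t^2) ∨ ψ x = 0) ∧
      (∀ x, (1/(2*s1^2) - 1/(2*s2^2)) * (x^2 - t^2) ≤ 0 ∨ ψ x = 1) := by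
    by_cases hs : s1 ≤ s2
    · set τ := Φinv (1 - a/2) with hτ
      have hτ0 : 0 < τ := Φ_inv_pos _ (by linarith) (by linarith)
      have hΦ : Φ τ = 1 - a/2 := Φ_inv _ (by linarith) (by linarith)
      have hb : 0 ≤ 1/(2*s1^2) - 1/(2*s2^2) := by
        rw [sub_nonneg]; gcongr
      have hint : ∀ s, 0 < s → ∫ x, (1 - ind (s1 * τ) (s * x)) ∂(gaussianReal 0 1)
          = 1 - (2 * Φ (s1 * τ / s) - 1) := by
        intro s hs
        simp_rw [ind_scale _ _ _ hs]
        rw [integral_sub (integrable_const _) (int01 _ _ (ind_meas _) (ind01 _)),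
          ind_int _ (by positivity)]
        simp
      refine ⟨fun x => 1 - ind (s1 * τ) x, s1 * τ, (ind_meas _).const_sub 1, ?_, ?_, ?_, ?_, ?_⟩
      · intro x; have := ind01 (s1*τ) x; constructor <;> linarith
      · rw [hint s1 h1, mul_div_cancel_left₀ _ h1.ne', hΦ]; ring
      · rw [hint s2 h2, Gtilde, if_pos hs, ← hτ, mul_div_right_comm]; ring
      · intro x
        by_cases hx : |x| ≤ s1 * τ
        · right; simp [ind, hx]
        · left
          apply mul_nonneg hb
          push Not at hx
          have := pow_lt_pow_left₀ hx (by positivity) two_ne_zero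
          rw [sq_abs] at this; linarith
      · intro x
        by_cases hx : |x| ≤ s1 * τ
        · left
          apply mul_nonpos_of_nonneg_of_nonpos hb
          have := pow_le_pow_left₀ (abs_nonneg x) hx 2
          rw [sq_abs] at this; linarith
        · right; simp [ind, hx]
    · set τ := Φinv ((a+1)/2) with hτ
      have hτ0 : 0 < τ := Φ_inv_pos _ (by linarith) (by linarith)
      have hΦ : Φ τ = (a+1)/2 := Φ_inv _ (by linarith) (by linarith)
      have hb : 1/(2*s1^2) - 1/(2*s2^2) ≤ 0 := by
        rw [sub_nonpos]; push Not at hs; gcongr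
      have hint : ∀ s, 0 < s → ∫ x, (ind (s1 * τ) (s * x)) ∂(gaussianReal 0 1)
          = (2 * Φ (s1 * τ / s) - 1) := by
        intro s hs
        simp_rw [ind_scale _ _ _ hs]
        rw [ind_int _ (by positivity)]
      refine ⟨fun x => ind (s1 * τ) x, s1 * τ, (ind_meas _), ind01 _, ?_, ?_, ?_, ?_⟩
      · rw [hint s1 h1, mul_div_cancel_left₀ _ h1.ne', hΦ]; ring
      · rw [hint s2 h2, Gtilde, if_neg hs, ← hτ, mul_div_right_comm]; ring
      · intro x
        by_cases hx : |x| ≤ s1 * τ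
        · left
          apply mul_nonneg_of_nonpos_of_nonpos hb
          have := pow_le_pow_left₀ (abs_nonneg x) hx 2
          rw [sq_abs] at this; linarith
        · right; simp [ind, hx]
      · intro x
        by_cases hx : |x| ≤ s1 * τ
        · right; simp [ind, hx]
        · left
          apply mul_nonpos_of_nonpos_of_nonneg hb
          push Not at hx
          have := pow_lt_pow_left₀ hx (by positivity) two_ne_zero
          rw [sq_abs] at this; linarith
  obtain ⟨ψ, t, m, b, e1, e2, hin, hout⟩ := main
  refine ⟨ψ, m, b, e1, e2, fun φ hφ hb hle => ?_⟩
  have := NP_gen s1 s2 t h1 h2 ψ φ m b hφ hb hin hout (by rw [e1]; exact hle)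
  linarith

theorem statement9 :
    ∃ C : ℝ, 0 < C ∧
      ∀ d : ℕ, 1 ≤ d → ∀ σθ σz : ℝ, 0 < σθ → 0 < σz → ∀ v w : Fin d → ℝ,
        ∀ α ∈ Ioo (C / d) (1 - C / d),
          Gtilde (Real.sqrt ((d : ℝ) * σθ ^ 2 + vnorm v ^ 2))
              (Real.sqrt ((d : ℝ) * σθ ^ 2 + vnorm w ^ 2)) (α + C / d) - C / d ≤
            tradeOff (scalarProductLaw d σθ σz v) (scalarProductLaw d σθ σz w) α ∧
          tradeOff (scalarProductLaw d σθ σz v) (scalarProductLaw d σθ σz w) α ≤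
            Gtilde (Real.sqrt ((d : ℝ) * σθ ^ 2 + vnorm v ^ 2))
              (Real.sqrt ((d : ℝ) * σθ ^ 2 + vnorm w ^ 2)) (α - C / d) + C / d := by
  obtain ⟨C, hC, hA⟩ := approx
  refine ⟨C, hC, ?_⟩
  intro d hd σθ σz hσθ hσz v w α hα
  have hd0 : (0:ℝ) < d := by exact_mod_cast hd
  have hδ : 0 < C / d := by positivity
  obtain ⟨hα0, hα1⟩ := hα
  have hv := hA d hd σθ σz hσθ hσz v
  have hw := hA d hd σθ σz hσθ hσz w
  have hs1 : 0 < Real.sqrt ((d : ℝ) * σθ ^ 2 + vnorm v ^ 2) := Real.sqrt_pos.2 (by positivity)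
  have hs2 : 0 < Real.sqrt ((d : ℝ) * σθ ^ 2 + vnorm w ^ 2) := Real.sqrt_pos.2 (by positivity)
  have hprob : ∀ u, IsProbabilityMeasure (scalarProductLaw d σθ σz u) := fun u =>
    Measure.isProbabilityMeasure_map (by fun_prop)
  set s1 := Real.sqrt ((d : ℝ) * σθ ^ 2 + vnorm v ^ 2)
  set s2 := Real.sqrt ((d : ℝ) * σθ ^ 2 + vnorm w ^ 2)
  set δ := C / d
  constructor
  · refine le_csInf ⟨1 - ∫ x, (0:ℝ) ∂(scalarProductLaw d σθ σz w), fun _ => 0, measurable_const,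
      fun x => by norm_num, by simp; linarith, rfl⟩ ?_
    rintro β ⟨φ, hφ, h01, hle, rfl⟩
    obtain ⟨-, -, -, -, -, hnp⟩ := NP s1 s2 (α + δ) hs1 hs2 (by linarith) (by linarith)
    have a1 := abs_le.1 (hv φ hφ h01)
    have a2 := abs_le.1 (hw φ hφ h01)
    have := hnp (fun x => φ (σz * x)) (hφ.comp (by fun_prop)) (fun x => h01 _) (by linarith)
    linarith [a2.1, a2.2]
  · obtain ⟨ψ, hψ, h01, e1, e2, -⟩ := NP s1 s2 (α - δ) hs1 hs2 (by linarith) (by linarith)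
    have hm : Measurable (fun y => ψ (y / σz)) := hψ.comp (by fun_prop)
    have a1 := abs_le.1 (hv (fun y => ψ (y / σz)) hm (fun x => h01 _))
    have a2 := abs_le.1 (hw (fun y => ψ (y / σz)) hm (fun x => h01 _))
    simp only [mul_div_cancel_left₀ _ hσz.ne'] at a1 a2
    rw [e1] at a1
    have hb : BddBelow {β : ℝ | ∃ φ : ℝ → ℝ, Measurable φ ∧ (∀ x, 0 ≤ φ x ∧ φ x ≤ 1) ∧
        (∫ x, φ x ∂(scalarProductLaw d σθ σz v)) ≤ α ∧
        β = 1 - ∫ x, φ x ∂(scalarProductLaw d σθ σz w)} := by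
      refine ⟨0, ?_⟩
      rintro β ⟨φ, hφ, hb, -, rfl⟩
      have := (int01_mem (scalarProductLaw d σθ σz w) φ hφ hb).2
      linarith
    refine (csInf_le hb ⟨_, hm, fun x => h01 _, by linarith [a1.2], rfl⟩).trans ?_
    linarith [a2.1]

end Paper
end
end

section
/- Let n, d, l ≥ 1 be integers, σ > 0, and v ∈ ℝ^{n×d} a deterministic matrix. Let N ∈ ℝ^{n×d} and Z ∈ ℝ^{d×l} be independent standard Gaussian matrices. Then the law of (σN + v)Z on ℝ^{n×l} is absolutely continuous with respect to the Lebesgue measure if and only if d ≥ min{n, l}. -/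
open MeasureTheory ProbabilityTheory Matrix Set

noncomputable section

namespace Paper

local instance {m n : ℕ} : BorelSpace (Matrix (Fin m) (Fin n) ℝ) :=
  inferInstanceAs (BorelSpace (Fin m → Fin n → ℝ))

local instance {m n : ℕ} : SecondCountableTopology (Matrix (Fin m) (Fin n) ℝ) :=
  inferInstanceAs (SecondCountableTopology (Fin m → Fin n → ℝ))

lemma measurable_det_sub {n l k : ℕ} (f : Fin k → Fin n) (g : Fin k → Fin l) :
    Measurable (fun A : Matrix (Fin n) (Fin l) ℝ => (A.submatrix f g).det) := by
  apply Continuous.measurable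
  exact (continuous_id.matrix_submatrix f g).matrix_det

lemma measurable_main {n d l : ℕ} (σ : ℝ) (v : Matrix (Fin n) (Fin d) ℝ) :
    Measurable (fun ω : Matrix (Fin n) (Fin d) ℝ × Matrix (Fin d) (Fin l) ℝ =>
          (σ • ω.1 + v) * ω.2) := by
  apply Continuous.measurable
  exact ((continuous_fst.const_smul σ).add continuous_const).matrix_mul continuous_snd

attribute [local instance] Matrix.normedAddCommGroup Matrix.normedSpace

local instance borelN {m n : ℕ} : @BorelSpace (Matrix (Fin m) (Fin n) ℝ)
    (Matrix.normedAddCommGroup.toMetricSpace.toUniformSpace.toTopologicalSpace) _ :=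
  inferInstanceAs (BorelSpace (Fin m → Fin n → ℝ))

local instance haarN {m n : ℕ} : @Measure.IsAddHaarMeasure (Matrix (Fin m) (Fin n) ℝ) _
    (Matrix.normedAddCommGroup.toMetricSpace.toUniformSpace.toTopologicalSpace) _
    (volume : Measure (Matrix (Fin m) (Fin n) ℝ)) :=
  Measure.pi.isAddHaarMeasure (fun _ : Fin m => (volume : Measure (Fin n → ℝ)))

local instance {m n : ℕ} : IsProbabilityMeasure (stdGaussianMatrix m n) := by
  unfold stdGaussianMatrix
  exact inferInstanceAs (IsProbabilityMeasure
    (Measure.pi fun _ : Fin m => Measure.pi fun _ : Fin n => gaussianReal 0 1))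

lemma pi_ac {α : Type*} [MeasurableSpace α] (μ ν : Measure α) [SigmaFinite μ] [SigmaFinite ν]
    (h : μ ≪ ν) (n : ℕ) :
    (Measure.pi fun _ : Fin n => μ) ≪ (Measure.pi fun _ : Fin n => ν) := by
  induction n with
  | zero =>
    rw [Measure.pi_of_empty, Measure.pi_of_empty]
  | succ n ih =>
    have h1 := (measurePreserving_piFinSuccAbove (fun _ : Fin (n + 1) => μ) 0).symm
    have h2 := (measurePreserving_piFinSuccAbove (fun _ : Fin (n + 1) => ν) 0).symm
    rw [← h1.map_eq, ← h2.map_eq]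
    exact (h.prod ih).map (MeasurableEquiv.measurable _)

lemma gauss_ac (m n : ℕ) : stdGaussianMatrix m n ≪ volume :=
  pi_ac _ _ (pi_ac _ _ (gaussianReal_absolutelyContinuous 0 one_ne_zero) n) m

lemma qmp_affine {E F : Type*} [NormedAddCommGroup E] [NormedSpace ℝ E] [MeasurableSpace E]
    [BorelSpace E] [FiniteDimensional ℝ E]
    [NormedAddCommGroup F] [NormedSpace ℝ F] [MeasurableSpace F] [BorelSpace F]
    [FiniteDimensional ℝ F]
    (μ' μ : Measure E) [μ.IsAddHaarMeasure] (ν : Measure F) [ν.IsAddHaarMeasure]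
    (hμ : μ' ≪ μ) (L : E →ₗ[ℝ] F) (hL : Function.Surjective L) (c : F) :
    Measure.QuasiMeasurePreserving (fun x => L x + c) μ' ν := by
  have hm : Measurable L := L.continuous_of_finiteDimensional.measurable
  obtain ⟨k, -, hk⟩ := L.exists_map_addHaar_eq_smul_addHaar μ ν hL
  have h1 : Measure.QuasiMeasurePreserving L μ' ν := by
    refine ⟨hm, (hμ.map hm).trans ?_⟩
    rw [hk]
    exact Measure.smul_absolutelyContinuous
  exact (measurePreserving_add_right ν c).quasiMeasurePreserving.comp h1

lemma ae_det {n l k : ℕ} (hn : k ≤ n) (hl : k ≤ l) :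
    ∀ᵐ A : Matrix (Fin n) (Fin l) ℝ,
      (A.submatrix (Fin.castLE hn) (Fin.castLE hl)).det ≠ 0 := by
  let E : Matrix (Fin n) (Fin l) ℝ := Matrix.of fun i j => if i.val = j.val then 1 else 0
  let L : ℝ →ₗ[ℝ] Matrix (Fin n) (Fin l) ℝ := LinearMap.toSpanSingleton ℝ _ E
  have hE : E.submatrix (Fin.castLE hn) (Fin.castLE hl) = 1 := by
    ext i j
    simp [E, Matrix.one_apply, Fin.ext_iff]
  refine ae_mem_of_ae_add_linearMap_mem (s := {A : Matrix (Fin n) (Fin l) ℝ |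
      (A.submatrix (Fin.castLE hn) (Fin.castLE hl)).det ≠ 0}) L volume volume
    ((measurable_det_sub _ _) (measurableSet_singleton 0).compl) ?_
  intro y
  set y' := y.submatrix (Fin.castLE hn) (Fin.castLE hl) with hy'
  have hfin : {t : ℝ | (-y').charpoly.IsRoot t}.Finite :=
    Polynomial.finite_setOfPred_isRoot (Matrix.charpoly_monic _).ne_zero
  have h0 := hfin.measure_zero (volume : Measure ℝ)
  rw [measure_eq_zero_iff_ae_notMem] at h0
  filter_upwards [h0] with t ht
  simp only [mem_ofPred_eq, Polynomial.IsRoot, Matrix.eval_charpoly] at ht ⊢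
  convert ht using 3
  rw [sub_neg_eq_add, add_comm]
  ext i j
  have := congrFun (congrFun hE i) j
  simp only [Matrix.submatrix_apply] at this
  simp [L, y', this, Matrix.scalar_apply, Matrix.diagonal_apply, Matrix.one_apply]

lemma surj_left {n d l : ℕ} (h : n ≤ d) (M : Matrix (Fin n) (Fin d) ℝ)
    (hM : (M.submatrix (Fin.castLE le_rfl) (Fin.castLE h)).det ≠ 0)
    (B : Matrix (Fin n) (Fin l) ℝ) : ∃ Z : Matrix (Fin d) (Fin l) ℝ, M * Z = B := by
  set M' := M.submatrix (Fin.castLE le_rfl) (Fin.castLE h) with hM'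
  have key : M * (1 : Matrix (Fin d) (Fin d) ℝ).submatrix id (Fin.castLE h) = M' := by
    have := Matrix.submatrix_mul M (1 : Matrix (Fin d) (Fin d) ℝ) id id (Fin.castLE h)
      Function.bijective_id
    rw [Matrix.mul_one] at this
    exact this.symm
  refine ⟨(1 : Matrix (Fin d) (Fin d) ℝ).submatrix id (Fin.castLE h) * (M'⁻¹ * B), ?_⟩
  rw [← Matrix.mul_assoc, key, ← Matrix.mul_assoc, Matrix.mul_nonsing_inv _ (Ne.isUnit hM),
    Matrix.one_mul]

lemma surj_right {n d l : ℕ} (h : l ≤ d) (Z : Matrix (Fin d) (Fin l) ℝ)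
    (hZ : (Z.submatrix (Fin.castLE h) (Fin.castLE le_rfl)).det ≠ 0)
    (B : Matrix (Fin n) (Fin l) ℝ) : ∃ M : Matrix (Fin n) (Fin d) ℝ, M * Z = B := by
  obtain ⟨X, hX⟩ := surj_left h Zᵀ (by
    rw [← Matrix.det_transpose]; exact hZ) Bᵀ
  refine ⟨Xᵀ, ?_⟩
  rw [← Matrix.transpose_inj, Matrix.transpose_mul, Matrix.transpose_transpose, hX]

def mulL {n d : ℕ} (l : ℕ) (M : Matrix (Fin n) (Fin d) ℝ) :
    Matrix (Fin d) (Fin l) ℝ →ₗ[ℝ] Matrix (Fin n) (Fin l) ℝ where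
  toFun Z := M * Z
  map_add' := Matrix.mul_add M
  map_smul' c Z := Matrix.mul_smul M c Z

def mulR {d l : ℕ} (n : ℕ) (Z : Matrix (Fin d) (Fin l) ℝ) :
    Matrix (Fin n) (Fin d) ℝ →ₗ[ℝ] Matrix (Fin n) (Fin l) ℝ where
  toFun M := M * Z
  map_add' A B := Matrix.add_mul A B Z
  map_smul' c M := Matrix.smul_mul c M Z


theorem statement12 (n d l : ℕ) (hn : 1 ≤ n) (hd : 1 ≤ d) (hl : 1 ≤ l)
    (σ : ℝ) (hσ : 0 < σ) (v : Matrix (Fin n) (Fin d) ℝ) :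
    (Measure.map
        (fun ω : Matrix (Fin n) (Fin d) ℝ × Matrix (Fin d) (Fin l) ℝ =>
          (σ • ω.1 + v) * ω.2)
        ((stdGaussianMatrix n d).prod (stdGaussianMatrix d l))) ≪
      (volume : Measure (Matrix (Fin n) (Fin l) ℝ)) ↔ min n l ≤ d := by
  have hmeas := measurable_main (l := l) σ v
  constructor
  · intro hac
    by_contra hlt
    obtain ⟨h1, h2⟩ := lt_min_iff.1 (not_le.1 hlt)
    have hnull := hac (ae_det (k := d + 1) h1 h2 :
      volume {A : Matrix (Fin n) (Fin l) ℝ |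
        (A.submatrix (Fin.castLE h1) (Fin.castLE h2)).det ≠ 0}ᶜ = 0)
    have hS : MeasurableSet {A : Matrix (Fin n) (Fin l) ℝ |
        (A.submatrix (Fin.castLE h1) (Fin.castLE h2)).det ≠ 0} :=
      (measurable_det_sub _ _) (measurableSet_singleton 0).compl
    rw [Measure.map_apply hmeas hS.compl] at hnull
    rw [show ((fun ω : Matrix (Fin n) (Fin d) ℝ × Matrix (Fin d) (Fin l) ℝ =>
          (σ • ω.1 + v) * ω.2) ⁻¹' {A : Matrix (Fin n) (Fin l) ℝ |
        (A.submatrix (Fin.castLE h1) (Fin.castLE h2)).det ≠ 0}ᶜ) = Set.univ from ?_] at hnull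
    · simp at hnull
    · rw [Set.eq_univ_iff_forall]
      rintro ⟨N, Z⟩
      simp only [mem_preimage, mem_compl_iff, mem_ofPred_eq, not_not]
      by_contra hdet
      rw [Matrix.submatrix_mul _ _ _ id _ Function.bijective_id] at hdet
      have hr := Matrix.rank_of_isUnit _ ((Matrix.isUnit_iff_isUnit_det _).2 (Ne.isUnit hdet))
      have h3 := Matrix.rank_mul_le_left ((σ • N + v).submatrix (Fin.castLE h1) id)
        (Z.submatrix id (Fin.castLE h2))
      have h4 := Matrix.rank_le_width ((σ • N + v).submatrix (Fin.castLE h1) id)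
      simp only [Fintype.card_fin] at hr
      omega
  · intro h
    refine Measure.QuasiMeasurePreserving.absolutelyContinuous ?_
    rcases min_le_iff.1 h with h | h
    · refine QuasiMeasurePreserving.prod_of_right hmeas ?_
      have hq : Measure.QuasiMeasurePreserving
          (fun N : Matrix (Fin n) (Fin d) ℝ => σ • N + v) (stdGaussianMatrix n d) volume :=
        qmp_affine _ volume volume (gauss_ac n d)
          (σ • (LinearMap.id : Matrix (Fin n) (Fin d) ℝ →ₗ[ℝ] _))
          (fun B => ⟨σ⁻¹ • B, by simp [smul_smul, hσ.ne']⟩) v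
      filter_upwards [hq.ae (ae_det le_rfl h)] with N hN
      have := qmp_affine _ volume volume (gauss_ac d l) (mulL l (σ • N + v))
        (surj_left h _ hN) 0
      simpa [mulL] using this
    · refine QuasiMeasurePreserving.prod_of_left hmeas ?_
      filter_upwards [(gauss_ac d l).ae_le (ae_det h le_rfl)] with Z hZ
      have := qmp_affine _ volume volume (gauss_ac n d) (σ • mulR n Z)
        (fun B => by
          obtain ⟨M, hM⟩ := surj_right (n := n) h Z hZ B
          exact ⟨σ⁻¹ • M, by simp [mulR, smul_smul, hσ.ne', hM]⟩) (v * Z)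
      simpa [mulR, Matrix.add_mul] using this

end Paper
end
end

section
/- Let n, d, l ≥ 1, σ > 0, and v, w ∈ ℝ^{n×d}. Set Σ_v = σ² I_n + v vᵀ and Σ_w = σ² I_n + w wᵀ, and let λ₁, …, λ_n be the eigenvalues of Σ_v^{−1/2} Σ_w Σ_v^{−1/2}; assume λ_k ≠ 1 for at least one k. For real weights c₁, …, c_n, let F_{c₁,…,c_n}(l, ·) denote the cumulative distribution function of ∑_{k=1}^n c_k Q_k, where Q₁, …, Q_n are i.i.d. chi-squared random variables with l degrees of freedom, and F⁻¹(l, ·) its quantile function. Then for all α ∈ (0,1): T(N(0, Σ_v ⊗ I_l), N(0, Σ_w ⊗ I_l))(α) = F_{(λ₁−1, …, λ_n−1)}(l, F⁻¹_{(1−1/λ₁, …, 1−1/λ_n)}(l, 1−α)). -/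
open MeasureTheory ProbabilityTheory Matrix Set

noncomputable section

namespace Paper

/-- The centered Gaussian distribution `N(0, S ⊗ I_l)` on `n×l` matrices:
the law of a random matrix with i.i.d. `N(0, S)` columns. -/
def gaussianMatrixCols (n l : ℕ) (S : Matrix (Fin n) (Fin n) ℝ) :
    Measure (Matrix (Fin n) (Fin l) ℝ) :=
  Measure.map (fun g : Fin l → Fin n → ℝ => Matrix.of fun i j => g j i)
    (Measure.pi fun _ : Fin l => gaussianVec 0 S)

/-- `F_{c₁,…,c_n}(l, x)`: cdf at `x` of `∑ₖ cₖ Qₖ` where `Q₁,…,Q_n` are i.i.d. chi-squared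
random variables with `l` degrees of freedom (each realized as a sum of `l` squares of
independent standard Gaussians). -/
def wchisqCDF (n l : ℕ) (c : Fin n → ℝ) (x : ℝ) : ℝ :=
  ((Measure.map (fun g : Fin n → Fin l → ℝ => ∑ k, c k * ∑ j, g k j ^ 2)
      (Measure.pi fun _ : Fin n => Measure.pi fun _ : Fin l => gaussianReal 0 1))
    (Iic x)).toReal

/-- The quantile function of the weighted sum of chi-squared variables. -/
def wchisqQuantile (n l : ℕ) (c : Fin n → ℝ) : ℝ → ℝ :=
  Function.invFun (wchisqCDF n l c)

lemma lintegral_fin_prod {n : ℕ} {X : Fin n → Type*} {mX : ∀ i, MeasurableSpace (X i)}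
    (μ : ∀ i, Measure (X i)) [∀ i, SigmaFinite (μ i)] (f : ∀ i, X i → ENNReal)
    (hf : ∀ i, Measurable (f i)) :
    ∫⁻ x, ∏ i, f i (x i) ∂(Measure.pi μ) = ∏ i, ∫⁻ x, f i x ∂(μ i) := by
  induction n with
  | zero => simp
  | succ n ih =>
    have h := ((measurePreserving_piFinSuccAbove μ 0).symm)
    rw [← h.lintegral_comp_emb (MeasurableEquiv.measurableEmbedding _)]
    simp_rw [MeasurableEquiv.piFinSuccAbove_symm_apply, Fin.insertNthEquiv,
        Fin.prod_univ_succ]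
    rw [← ih (fun i => μ i.succ) (fun i => f i.succ) (fun i => hf _)]
    refine lintegral_prod_mul (μ := μ 0) (ν := Measure.pi fun i : Fin n => μ i.succ)
      (f := f 0) (g := fun x => ∏ i : Fin n, f i.succ (x i)) (hf 0).aemeasurable ?_
    exact (Finset.measurable_prod _ fun i _ => (hf i.succ).comp (measurable_pi_apply i)).aemeasurable

lemma pi_withDensity_fin {n : ℕ} {X : Fin n → Type*} {mX : ∀ i, MeasurableSpace (X i)}
    (μ : ∀ i, Measure (X i)) [∀ i, SigmaFinite (μ i)] (f : ∀ i, X i → ENNReal)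
    (hf : ∀ i, Measurable (f i)) [∀ i, SigmaFinite ((μ i).withDensity (f i))] :
    Measure.pi (fun i => (μ i).withDensity (f i)) =
      (Measure.pi μ).withDensity (fun x => ∏ i, f i (x i)) := by
  refine Measure.pi_eq fun s hs => ?_
  rw [withDensity_apply _ (MeasurableSet.univ_pi hs), ← lintegral_indicator (MeasurableSet.univ_pi hs)]
  have : ∀ x : (∀ i, X i), (Set.pi univ s).indicator (fun x => ∏ i, f i (x i)) x
      = ∏ i, (s i).indicator (f i) (x i) := by
    intro x
    by_cases hx : x ∈ Set.pi univ s
    · rw [indicator_of_mem hx]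
      refine Finset.prod_congr rfl fun i _ => ?_
      rw [indicator_of_mem (hx i (mem_univ i))]
    · rw [indicator_of_notMem hx]
      simp only [Set.mem_pi, mem_univ, true_implies, not_forall] at hx
      obtain ⟨i, hi⟩ := hx
      exact (Finset.prod_eq_zero (Finset.mem_univ i) (indicator_of_notMem hi _)).symm
  simp_rw [this]
  rw [lintegral_fin_prod μ _ (fun i => (hf i).indicator (hs i))]
  refine Finset.prod_congr rfl fun i _ => ?_
  rw [lintegral_indicator (hs i), withDensity_apply _ (hs i)]

lemma pi_level_null {n : ℕ} {X : Type*} [MeasurableSpace X] (μ : Measure X)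
    [IsProbabilityMeasure μ] (h : X → ℝ) (hh : Measurable h) (h0 : ∀ y, μ {x | h x = y} = 0)
    (c : Fin n → ℝ) (k : Fin n) (hk : c k ≠ 0) (y : ℝ) :
    (Measure.pi fun _ : Fin n => μ) {g | ∑ i, c i * h (g i) = y} = 0 := by
  cases n with
  | zero => exact k.elim0
  | succ n =>
    have hm := ((measurePreserving_piFinSuccAbove (fun _ : Fin (n+1) => μ) k).symm)
    have hmeas : MeasurableSet {g : Fin (n+1) → X | ∑ i, c i * h (g i) = y} :=
      measurableSet_eq_fun (by fun_prop) measurable_const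
    rw [← hm.measure_preimage hmeas.nullMeasurableSet]
    have hae : ∀ z, μ.prod (Measure.pi fun _ : Fin n => μ) {p : X × (Fin n → X) | c k * h p.1 + ∑ i, c (k.succAbove i) * h (p.2 i) = z} = 0 := by
      intro z
      have hms : MeasurableSet {p : X × (Fin n → X) | c k * h p.1 + ∑ i, c (k.succAbove i) * h (p.2 i) = z} :=
        measurableSet_eq_fun (by fun_prop) measurable_const
      rw [Measure.prod_apply_symm hms]
      simp only [preimage_ofPred_eq]
      rw [lintegral_eq_zero_iff']
      · refine ae_of_all _ fun q => ?_
        refine (congrArg μ ?_).trans (h0 ((z - ∑ i, c (k.succAbove i) * h (q i)) / c k))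
        ext x
        simp only [mem_ofPred_eq]
        rw [eq_div_iff hk]
        constructor <;> intro hh <;> linarith
      · exact (measurable_measure_prodMk_right hms).aemeasurable
    refine (congrArg _ ?_).trans (hae y)
    ext p
    simp only [mem_preimage, mem_ofPred_eq, MeasurableEquiv.piFinSuccAbove_symm_apply, Fin.insertNthEquiv]
    rw [Fin.sum_univ_succAbove _ k]
    simp

lemma swap_pi (n l : ℕ) (μ : Measure ℝ) [IsProbabilityMeasure μ] :
    Measure.map (fun (g : Fin l → Fin n → ℝ) (i : Fin n) (j : Fin l) => g j i)
      (Measure.pi fun _ => Measure.pi fun _ => μ) =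
    (Measure.pi fun _ => Measure.pi fun _ => μ) := by
  simp_rw [← Measure.infinitePi_eq_pi]
  rw [← Measure.infinitePi_map_curry (fun (_ : Fin l) (_ : Fin n) => μ),
    ← Measure.infinitePi_map_curry (fun (_ : Fin n) (_ : Fin l) => μ),
    Measure.map_map (by fun_prop) (by fun_prop)]
  have := Measure.infinitePi_map_piCongrLeft (fun p : Fin n × Fin l => μ) (Equiv.prodComm (Fin l) (Fin n))
  rw [← this, Measure.map_map (by fun_prop) (by fun_prop)]
  congr 1

lemma neyman_pearson {E : Type*} [MeasurableSpace E] (P Q : Measure E) [IsProbabilityMeasure P]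
    [IsProbabilityMeasure Q] (f : E → ℝ) (hf : Measurable f) (hf0 : ∀ x, 0 ≤ f x)
    (hQ : Q = P.withDensity (fun x => ENNReal.ofReal (f x))) (c : ℝ) (hc : 0 ≤ c) (α : ℝ)
    (hα : P.real {x | f x ≤ c} = 1 - α) :
    tradeOff P Q α = Q.real {x | f x ≤ c} := by
  have hA : MeasurableSet {x | c < f x} := measurableSet_lt measurable_const hf
  have hAc : {x | f x ≤ c} = {x | c < f x}ᶜ := by ext; simp
  rw [hAc, probReal_compl_eq_one_sub hA] at hα
  rw [hAc, probReal_compl_eq_one_sub hA]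
  have hfi : Integrable f P := by
    refine ⟨hf.aestronglyMeasurable, ?_⟩
    rw [hasFiniteIntegral_iff_ofReal (ae_of_all _ hf0)]
    have h1 : Q univ = 1 := measure_univ
    rw [hQ, withDensity_apply _ MeasurableSet.univ, Measure.restrict_univ] at h1
    rw [h1]; exact ENNReal.one_lt_top
  have hint : ∀ φ : E → ℝ, ∫ x, φ x ∂Q = ∫ x, f x * φ x ∂P := by
    intro φ
    rw [hQ, integral_withDensity_eq_integral_toReal_smul (by fun_prop) (by simp)]
    simp [ENNReal.toReal_ofReal (hf0 _)]
  have key : ∀ φ : E → ℝ, Measurable φ → (∀ x, 0 ≤ φ x ∧ φ x ≤ 1) → ∫ x, φ x ∂P ≤ α →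
      ∫ x, φ x ∂Q ≤ Q.real {x | c < f x} := by
    intro φ hφ h01 hle
    have e1 : Q.real {x | c < f x} = ∫ x, f x * ({x | c < f x}.indicator (fun _ => (1:ℝ)) x) ∂P := by
      rw [← hint, integral_indicator hA]; simp
    have e2 : P.real {x | c < f x} = ∫ x, ({x | c < f x}.indicator (fun _ => (1:ℝ)) x) ∂P := by
      rw [integral_indicator hA]; simp
    have i1 : Integrable φ P := Integrable.of_bound hφ.aestronglyMeasurable 1
      (ae_of_all _ fun x => by rw [Real.norm_eq_abs, abs_of_nonneg (h01 x).1]; exact (h01 x).2)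
    have i2 : Integrable ({x | c < f x}.indicator (fun _ => (1:ℝ))) P := 
      (integrable_const _).indicator hA
    have i3 : Integrable (fun x => f x * φ x) P := hfi.mul_bdd (c := 1) hφ.aestronglyMeasurable
      (ae_of_all _ fun x => by rw [Real.norm_eq_abs, abs_of_nonneg (h01 x).1]; exact (h01 x).2)
    have i4 : Integrable (fun x => f x * ({x | c < f x}.indicator (fun _ => (1:ℝ)) x)) P :=
      hfi.mul_bdd (c := 1) i2.1
      (ae_of_all _ fun x => by by_cases h : x ∈ {x | c < f x} <;> simp [indicator, h])
    rw [hint, e1]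
    have : ∫ x, (f x * φ x + c * ({x | c < f x}.indicator (fun _ => (1:ℝ)) x)) ∂P ≤ 
        ∫ x, (f x * ({x | c < f x}.indicator (fun _ => (1:ℝ)) x) + c * φ x) ∂P := by
      refine integral_mono (i3.add (i2.const_mul c)) (i4.add (i1.const_mul c)) fun x => ?_
      dsimp only
      by_cases h : c < f x
      · rw [indicator_of_mem (by exact h)]; nlinarith [h01 x]
      · rw [indicator_of_notMem (by exact h)]; nlinarith [h01 x]
    rw [integral_add i3 (i2.const_mul c), integral_add i4 (i1.const_mul c), integral_const_mul,
      integral_const_mul, ← e2] at this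
    have h2 : P.real {x | c < f x} = α := by linarith
    rw [h2] at this
    nlinarith
  have hPA : P.real {x | c < f x} = α := by linarith
  apply IsLeast.csInf_eq
  constructor
  · refine ⟨{x | c < f x}.indicator (fun _ => (1:ℝ)), measurable_const.indicator hA, ?_, ?_, ?_⟩
    · intro x; by_cases h : c < f x <;> simp [indicator, h]
    · rw [integral_indicator hA]; simp [hPA]
    · rw [integral_indicator hA]; simp
  · rintro β ⟨φ, h1, h2, h3, rfl⟩
    linarith [key φ h1 h2 h3]

lemma tradeOff_map {E F : Type*} [MeasurableSpace E] [MeasurableSpace F] (P Q : Measure E)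
    (e : E → F) (e' : F → E) (he : Measurable e) (he' : Measurable e') (hl : ∀ x, e' (e x) = x)
    (α : ℝ) : tradeOff (P.map e) (Q.map e) α = tradeOff P Q α := by
  unfold tradeOff
  congr 1
  ext β
  constructor
  · rintro ⟨φ, h1, h2, h3, h4⟩
    rw [integral_map he.aemeasurable h1.aestronglyMeasurable] at h3 h4
    exact ⟨fun x => φ (e x), h1.comp he, fun x => h2 _, h3, h4⟩
  · rintro ⟨φ, h1, h2, h3, h4⟩
    refine ⟨fun x => φ (e' x), h1.comp he', fun x => h2 _, ?_, ?_⟩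
    · rw [integral_map he.aemeasurable (by exact (h1.comp he').aestronglyMeasurable)]; simpa [hl] using h3
    · rw [integral_map he.aemeasurable (by exact (h1.comp he').aestronglyMeasurable)]; simpa [hl] using h4
lemma gaussianReal_withDensity (v : NNReal) (hv : v ≠ 0) :
    gaussianReal 0 v = (gaussianReal 0 1).withDensity
      (fun x => ENNReal.ofReal ((Real.sqrt v)⁻¹ * Real.exp (1/2 * ((1 - 1 / (v:ℝ)) * x ^ 2)))) := by
  have hv' : (0:ℝ) < v := by positivity
  rw [gaussianReal_of_var_ne_zero _ hv, gaussianReal_of_var_ne_zero _ one_ne_zero,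
    ← withDensity_mul _ (by fun_prop) (by fun_prop)]
  congr 1
  ext x
  simp only [Pi.mul_apply, gaussianPDF, gaussianPDFReal]
  rw [← ENNReal.ofReal_mul (by positivity)]
  congr 1
  rw [Real.sqrt_mul (by positivity)]
  have : Real.exp (-(x - 0) ^ 2 / (2 * (v:ℝ))) =
    Real.exp (-(x - 0) ^ 2 / (2 * ((1:NNReal):ℝ))) * Real.exp (1/2 * ((1 - 1 / (v:ℝ)) * x ^ 2)) := by
    rw [← Real.exp_add]; congr 1; simp only [NNReal.coe_one]; field_simp; ring
  rw [this]
  simp only [NNReal.coe_one, mul_one, mul_inv]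
  ring

lemma stdGaussian_density (k : ℕ) :
    (Measure.pi fun _ : Fin k => gaussianReal 0 1) = volume.withDensity
      (fun x : Fin k → ℝ => ENNReal.ofReal ((Real.sqrt (2 * Real.pi))⁻¹ ^ k * Real.exp (-(1/2) * (x ⬝ᵥ x)))) := by
  have h : gaussianReal 0 1 = volume.withDensity (gaussianPDF 0 1) :=
    gaussianReal_of_var_ne_zero _ one_ne_zero
  have : SigmaFinite (volume.withDensity (gaussianPDF 0 1)) := by rw [← h]; infer_instance
  rw [h, pi_withDensity_fin (fun _ => volume) (fun _ => gaussianPDF 0 1) (fun _ => by fun_prop),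
    ← volume_pi]
  congr 1
  ext x
  simp only [gaussianPDF, gaussianPDFReal]
  rw [← ENNReal.ofReal_prod_of_nonneg (fun i _ => by positivity), Finset.prod_mul_distrib,
    ← Real.exp_sum]
  congr 3
  · simp
  · simp only [dotProduct, Finset.mul_sum]
    refine Finset.sum_congr rfl fun i _ => ?_
    simp; ring

lemma gaussianVec_eq_map {k : ℕ} (L : Matrix (Fin k) (Fin k) ℝ) (hL : L.det ≠ 0) :
    gaussianVec 0 (L * Lᵀ) =
      Measure.map (fun x => L *ᵥ x) (Measure.pi fun _ : Fin k => gaussianReal 0 1) := by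
  have hm : Measurable (fun x : Fin k → ℝ => L *ᵥ x) :=
    (Continuous.matrix_mulVec continuous_const continuous_id).measurable
  have hvol := Real.map_matrix_volume_pi_eq_smul_volume_pi hL
  have hv : (volume : Measure (Fin k → ℝ)) =
      ENNReal.ofReal |L.det| • Measure.map (fun x => L *ᵥ x) volume := by
    have : (⇑(toLin' L)) = (fun x => L *ᵥ x) := by ext; simp
    rw [← this, hvol, smul_smul, ← ENNReal.ofReal_mul (abs_nonneg _), ← abs_mul,
      mul_inv_cancel₀ hL]
    simp
  rw [stdGaussian_density]
  unfold gaussianVec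
  ext s hs
  have hd : Measurable fun x : Fin k → ℝ => x ⬝ᵥ x := by
    simp only [dotProduct]; fun_prop
  have hd2 : Measurable fun x : Fin k → ℝ => ((x - 0) ⬝ᵥ ((L * Lᵀ)⁻¹ *ᵥ (x - 0))) :=
    (Continuous.dotProduct (by fun_prop) (Continuous.matrix_mulVec continuous_const (by fun_prop))).measurable
  rw [Measure.map_apply hm hs, withDensity_apply _ hs, withDensity_apply _ (hm hs)]
  conv_lhs => rw [hv]
  rw [Measure.restrict_smul, lintegral_smul_measure, setLIntegral_map hs (by fun_prop) hm,
    smul_eq_mul, ← lintegral_const_mul _ (by fun_prop)]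
  refine lintegral_congr fun x => ?_
  rw [← ENNReal.ofReal_mul (abs_nonneg _), ← mul_assoc]
  congr 2
  · rw [Matrix.det_mul, Matrix.det_transpose, Real.mul_rpow (by positivity) (mul_self_nonneg _)]
    have e1 : (L.det * L.det) ^ (-(1:ℝ)/2) = |L.det|⁻¹ := by
      rw [← abs_mul_abs_self, ← sq, ← Real.rpow_natCast, ← Real.rpow_mul (abs_nonneg _)]
      norm_num
      rw [Real.rpow_neg_one]
    have e2 : ((2 * Real.pi) ^ k) ^ (-(1:ℝ)/2) = (Real.sqrt (2 * Real.pi))⁻¹ ^ k := by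
      rw [Real.sqrt_eq_rpow, ← Real.rpow_neg (by positivity), ← Real.rpow_natCast,
        ← Real.rpow_natCast, ← Real.rpow_mul (by positivity), ← Real.rpow_mul (by positivity)]
      congr 1; ring
    rw [e1, e2]
    field_simp
  · congr 2
    have hu : IsUnit L.det := isUnit_iff_ne_zero.mpr hL
    rw [sub_zero, Matrix.mul_inv_rev, Matrix.mulVec_mulVec, Matrix.mul_assoc,
      Matrix.nonsing_inv_mul _ hu, Matrix.mul_one, Matrix.dotProduct_mulVec,
      ← Matrix.vecMul_transpose, Matrix.vecMul_vecMul, Matrix.mul_nonsing_inv _ (by simpa using hu),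
      Matrix.vecMul_one]

def stdG (n l : ℕ) : Measure (Fin n → Fin l → ℝ) :=
  Measure.pi fun _ : Fin n => Measure.pi fun _ : Fin l => gaussianReal 0 1

instance (n l : ℕ) : IsProbabilityMeasure (stdG n l) := by unfold stdG; infer_instance

lemma measurable_mulMat {n l : ℕ} (L : Matrix (Fin n) (Fin n) ℝ) :
    Measurable (fun g : Fin n → Fin l → ℝ => (L * Matrix.of g : Matrix (Fin n) (Fin l) ℝ)) := by
  refine measurable_pi_lambda _ fun i => measurable_pi_lambda _ fun j => ?_
  simp only [Matrix.mul_apply, Matrix.of_apply]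
  fun_prop

lemma gaussianMatrixCols_eq_map {n l : ℕ} (L : Matrix (Fin n) (Fin n) ℝ) (hL : L.det ≠ 0) :
    gaussianMatrixCols n l (L * Lᵀ) =
      Measure.map (fun g : Fin n → Fin l → ℝ => (L * Matrix.of g : Matrix (Fin n) (Fin l) ℝ)) (stdG n l) := by
  have hm : Measurable (fun x : Fin n → ℝ => L *ᵥ x) :=
    (Continuous.matrix_mulVec continuous_const continuous_id).measurable
  have : IsProbabilityMeasure (Measure.map (fun x => L *ᵥ x) (Measure.pi fun _ : Fin n => gaussianReal 0 1)) :=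
    Measure.isProbabilityMeasure_map hm.aemeasurable
  have hs : Measurable (fun g : Fin l → Fin n → ℝ => (Matrix.of fun i j => g j i : Matrix (Fin n) (Fin l) ℝ)) :=
    measurable_pi_lambda _ fun i => measurable_pi_lambda _ fun j => by
      simp only [Matrix.of_apply]; fun_prop
  unfold gaussianMatrixCols stdG
  rw [gaussianVec_eq_map L hL, ← Measure.pi_map_pi (fun _ => hm.aemeasurable),
    Measure.map_map hs (by fun_prop), ← swap_pi n l, Measure.map_map (measurable_mulMat L) (by fun_prop)]
  congr 1

lemma scale_density (n l : ℕ) (lam : Fin n → ℝ) (hlam : ∀ k, 0 < lam k) :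
    Measure.map (fun g : Fin n → Fin l → ℝ => fun k j => Real.sqrt (lam k) * g k j) (stdG n l) =
      (stdG n l).withDensity (fun g => ENNReal.ofReal ((∏ k, (Real.sqrt (lam k))⁻¹ ^ l) *
        Real.exp (1/2 * ∑ k, (1 - 1 / lam k) * ∑ j, g k j ^ 2))) := by
  unfold stdG
  have h1 : ∀ k, Measure.map (fun x => Real.sqrt (lam k) * x) (gaussianReal 0 1) =
      (gaussianReal 0 1).withDensity (fun x => ENNReal.ofReal ((Real.sqrt (lam k))⁻¹ *
        Real.exp (1/2 * ((1 - 1 / (lam k)) * x ^ 2)))) := by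
    intro k
    have := gaussianReal_withDensity ⟨lam k, (hlam k).le⟩ (by
      intro h; exact (hlam k).ne' (congrArg NNReal.toReal h))
    change gaussianReal 0 _ = (gaussianReal 0 1).withDensity (fun x => ENNReal.ofReal ((Real.sqrt (lam k))⁻¹ *
        Real.exp (1/2 * ((1 - 1 / (lam k)) * x ^ 2)))) at this
    rw [gaussianReal_map_const_mul, ← this]
    congr 1
    · simp
    · ext; simp [Real.sq_sqrt (hlam k).le]; rfl
  have : ∀ k, IsProbabilityMeasure ((gaussianReal 0 1).withDensity (fun x => ENNReal.ofReal ((Real.sqrt (lam k))⁻¹ *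
        Real.exp (1/2 * ((1 - 1 / (lam k)) * x ^ 2))))) := by
    intro k; rw [← h1]; exact Measure.isProbabilityMeasure_map (by fun_prop)
  have h2 : ∀ k, Measure.map (fun (x : Fin l → ℝ) j => Real.sqrt (lam k) * x j) (Measure.pi fun _ : Fin l => gaussianReal 0 1) =
      (Measure.pi fun _ : Fin l => gaussianReal 0 1).withDensity (fun x => ∏ j, ENNReal.ofReal ((Real.sqrt (lam k))⁻¹ *
        Real.exp (1/2 * ((1 - 1 / (lam k)) * x j ^ 2)))) := by
    intro k
    have : SigmaFinite (Measure.map (fun x => Real.sqrt (lam k) * x) (gaussianReal 0 1)) := by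
      rw [h1]; infer_instance
    rw [Measure.pi_map_pi (f := fun _ x => Real.sqrt (lam k) * x) (fun _ => by fun_prop), h1,
      pi_withDensity_fin (fun _ => gaussianReal 0 1) (fun _ x => ENNReal.ofReal ((Real.sqrt (lam k))⁻¹ *
        Real.exp (1/2 * ((1 - 1 / (lam k)) * x ^ 2)))) (fun _ => by fun_prop)]
  have : ∀ k, IsProbabilityMeasure ((Measure.pi fun _ : Fin l => gaussianReal 0 1).withDensity (fun x => ∏ j, ENNReal.ofReal ((Real.sqrt (lam k))⁻¹ *
        Real.exp (1/2 * ((1 - 1 / (lam k)) * x j ^ 2))))) := by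
    intro k; rw [← h2]; exact Measure.isProbabilityMeasure_map (Measurable.aemeasurable (by fun_prop))
  have : ∀ k, SigmaFinite (Measure.map (fun (x : Fin l → ℝ) j => Real.sqrt (lam k) * x j) (Measure.pi fun _ : Fin l => gaussianReal 0 1)) := by
    intro k; rw [h2]; infer_instance
  rw [Measure.pi_map_pi (f := fun k (x : Fin l → ℝ) j => Real.sqrt (lam k) * x j) (fun _ => Measurable.aemeasurable (by fun_prop))]
  simp_rw [h2]
  rw [pi_withDensity_fin (fun _ => Measure.pi fun _ : Fin l => gaussianReal 0 1) (fun k x => ∏ j, ENNReal.ofReal ((Real.sqrt (lam k))⁻¹ *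
        Real.exp (1/2 * ((1 - 1 / (lam k)) * x j ^ 2)))) (fun _ => by fun_prop)]
  congr 1
  ext g
  have : ∀ k, ∏ j, ENNReal.ofReal ((Real.sqrt (lam k))⁻¹ *
        Real.exp (1/2 * ((1 - 1 / (lam k)) * g k j ^ 2))) =
      ENNReal.ofReal ((Real.sqrt (lam k))⁻¹ ^ l * Real.exp (1/2 * ((1 - 1 / lam k) * ∑ j, g k j ^ 2))) := by
    intro k
    rw [← ENNReal.ofReal_prod_of_nonneg (fun i _ => by positivity), Finset.prod_mul_distrib,
      ← Real.exp_sum, Finset.mul_sum, Finset.mul_sum]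
    simp
  simp_rw [this]
  rw [← ENNReal.ofReal_prod_of_nonneg (fun i _ => by positivity), Finset.prod_mul_distrib,
      ← Real.exp_sum, Finset.mul_sum]

lemma exists_quantile (n l : ℕ) (hl : 1 ≤ l) (c : Fin n → ℝ) (hc : ∃ k, c k ≠ 0) (p : ℝ)
    (hp : p ∈ Ioo (0:ℝ) 1) : ∃ t, wchisqCDF n l c t = p := by
  set T := (fun g : Fin n → Fin l → ℝ => ∑ k, c k * ∑ j, g k j ^ 2) with hT
  have hTm : Measurable T := by fun_prop
  set ν := Measure.map T (stdG n l) with hν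
  have : IsProbabilityMeasure ν := Measure.isProbabilityMeasure_map hTm.aemeasurable
  have hcdf : ∀ x, wchisqCDF n l c x = cdf ν x := fun x => by rw [cdf_eq_real]; rfl
  have hatom : ∀ x, ν {x} = 0 := by
    intro x
    obtain ⟨k, hk⟩ := hc
    rw [hν, Measure.map_apply hTm (measurableSet_singleton x)]
    refine pi_level_null _ (fun a : Fin l → ℝ => ∑ j, a j ^ 2) (by fun_prop) ?_ c k hk x
    intro y
    have := pi_level_null (n := l) (gaussianReal 0 1) (fun x => x ^ 2) (by fun_prop) ?_ (fun _ => 1) ⟨0, hl⟩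
      one_ne_zero y
    · simpa using this
    · intro y
      have := nullSingletonClass_gaussianReal (μ := 0) (v := 1) one_ne_zero
      refine Set.Finite.measure_zero ?_ _
      refine Set.Finite.subset (Set.toFinite {Real.sqrt y, - Real.sqrt y}) ?_
      intro x hx
      have hx : x ^ 2 = y := hx
      rw [← hx, Real.sqrt_sq_eq_abs]
      rcases abs_choice x with h | h <;> simp [h]
  have hcont : Continuous (cdf ν) := by
    rw [continuous_iff_continuousAt]
    intro x
    have hle : Function.leftLim (cdf ν) x = cdf ν x := by
      have h1 := (cdf ν).measure_singleton x
      rw [measure_cdf, hatom] at h1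
      have h2 := (cdf ν).mono.leftLim_le (le_refl x)
      have h3 : cdf ν x - Function.leftLim (cdf ν) x ≤ 0 := ENNReal.ofReal_eq_zero.mp h1.symm
      linarith
    rw [(cdf ν).mono.continuousAt_iff_leftLim_eq_rightLim, hle, (cdf ν).rightLim_eq]
  obtain ⟨a, ha⟩ := ((tendsto_cdf_atBot ν).eventually (eventually_lt_nhds hp.1)).exists
  obtain ⟨b, hb⟩ := ((tendsto_cdf_atTop ν).eventually (eventually_gt_nhds hp.2)).exists
  obtain ⟨t, ht⟩ := mem_range_of_exists_le_of_exists_ge hcont ⟨a, ha.le⟩ ⟨b, hb.le⟩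
  exact ⟨t, by rw [hcdf, ht]⟩

theorem statement16 (n d l : ℕ) (hn : 1 ≤ n) (hd : 1 ≤ d) (hl : 1 ≤ l)
    (σ : ℝ) (hσ : 0 < σ) (v w : Matrix (Fin n) (Fin d) ℝ)
    (Sv Sw : Matrix (Fin n) (Fin n) ℝ)
    (hSv : Sv = σ ^ 2 • (1 : Matrix (Fin n) (Fin n) ℝ) + v * vᵀ)
    (hSw : Sw = σ ^ 2 • (1 : Matrix (Fin n) (Fin n) ℝ) + w * wᵀ)
    -- R = Sv^{-1/2}: the inverse of the symmetric positive definite square root of Sv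
    (R : Matrix (Fin n) (Fin n) ℝ) (hRpd : R.PosDef) (hR : R * Sv * R = 1)
    -- λ₁, …, λ_n are the eigenvalues of Sv^{-1/2} Sw Sv^{-1/2}
    (lam : Fin n → ℝ)
    (hlam : ∃ U : Matrix (Fin n) (Fin n) ℝ, U * Uᵀ = 1 ∧
      R * Sw * R = U * Matrix.diagonal lam * Uᵀ)
    -- at least one eigenvalue differs from 1
    (hone : ∃ k, lam k ≠ 1)
    (α : ℝ) (hα : α ∈ Ioo (0:ℝ) 1) :
    tradeOff (gaussianMatrixCols n l Sv) (gaussianMatrixCols n l Sw) α =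
      wchisqCDF n l (fun k => lam k - 1)
        (wchisqQuantile n l (fun k => 1 - 1 / lam k) (1 - α)) := by
  obtain ⟨U, hU, hRU⟩ := hlam
  have hRu : IsUnit R.det := isUnit_iff_ne_zero.mpr hRpd.det_pos.ne'
  have hRt : Rᵀ = R := by simpa using hRpd.1.eq
  have hU' : Uᵀ * U = 1 := mul_eq_one_comm.mp hU
  have hUu : IsUnit U.det := by
    refine isUnit_iff_ne_zero.mpr fun h => ?_
    have := congrArg Matrix.det hU
    simp [h] at this
  have hSwpd : Sw.PosDef := by
    rw [hSw]
    refine Matrix.PosDef.add_posSemidef ?_ ?_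
    · exact Matrix.PosDef.one.smul (by positivity)
    · simpa using Matrix.posSemidef_self_mul_conjTranspose w
  have hdiag : Matrix.diagonal lam = (R * U)ᴴ * Sw * (R * U) := by
    rw [Matrix.conjTranspose_eq_transpose_of_trivial, Matrix.transpose_mul, hRt]
    calc Matrix.diagonal lam = (Uᵀ * U) * Matrix.diagonal lam * (Uᵀ * U) := by simp [hU']
      _ = Uᵀ * (U * Matrix.diagonal lam * Uᵀ) * U := by simp only [Matrix.mul_assoc]
      _ = _ := by rw [← hRU]; simp only [Matrix.mul_assoc]
  have hlpos : ∀ k, 0 < lam k := by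
    rw [← Matrix.posDef_diagonal_iff, hdiag]
    refine hSwpd.conjTranspose_mul_mul_same ?_
    apply Matrix.mulVec_injective_of_isUnit
    rw [Matrix.isUnit_iff_isUnit_det, Matrix.det_mul]
    exact hRu.mul hUu
  set A : Matrix (Fin n) (Fin n) ℝ := R⁻¹ * U with hA
  set D : Matrix (Fin n) (Fin n) ℝ := Matrix.diagonal (fun k => Real.sqrt (lam k)) with hD
  have hAu : IsUnit A.det := by
    rw [hA, Matrix.det_mul]; exact (Matrix.isUnit_nonsing_inv_det R hRu).mul hUu
  have hDu : D.det ≠ 0 := by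
    rw [hD, Matrix.det_diagonal]
    exact Finset.prod_ne_zero_iff.mpr fun k _ => (Real.sqrt_pos.mpr (hlpos k)).ne'
  have hRit : (R⁻¹)ᵀ = R⁻¹ := by rw [Matrix.transpose_nonsing_inv, hRt]
  have cancel : ∀ X : Matrix (Fin n) (Fin n) ℝ, R⁻¹ * (R * X * R) * R⁻¹ = X := by
    intro X
    rw [Matrix.mul_assoc R X R, ← Matrix.mul_assoc R⁻¹, Matrix.nonsing_inv_mul _ hRu,
      Matrix.one_mul, Matrix.mul_assoc, Matrix.mul_nonsing_inv _ hRu, Matrix.mul_one]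
  have hSvA : Sv = A * Aᵀ := by
    rw [hA, Matrix.transpose_mul, hRit, ← cancel Sv, hR, ← hU]
    simp only [Matrix.mul_assoc]
  have hDD : D * Dᵀ = Matrix.diagonal lam := by
    rw [hD, Matrix.diagonal_transpose, Matrix.diagonal_mul_diagonal]
    congr 1; ext k; exact Real.mul_self_sqrt (hlpos k).le
  have hSwA : Sw = (A * D) * (A * D)ᵀ := by
    rw [hA, Matrix.transpose_mul, Matrix.transpose_mul, hRit, ← cancel Sw, hRU, ← hDD]
    simp only [Matrix.mul_assoc]
  set f : (Fin n → Fin l → ℝ) → (Fin n → Fin l → ℝ) :=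
    fun g k j => Real.sqrt (lam k) * g k j with hf
  have hfm : Measurable f := by fun_prop
  have hQmap : gaussianMatrixCols n l Sw =
      Measure.map (fun g : Fin n → Fin l → ℝ => (A * Matrix.of g : Matrix (Fin n) (Fin l) ℝ))
        (Measure.map f (stdG n l)) := by
    rw [hSwA, gaussianMatrixCols_eq_map _ (by rw [Matrix.det_mul]; exact mul_ne_zero hAu.ne_zero hDu),
      Measure.map_map (measurable_mulMat A) hfm]
    congr 1
    ext g : 1
    simp only [Function.comp]
    rw [Matrix.mul_assoc]
    congr 1
    ext k j
    simp [hD, hf, Matrix.diagonal_mul]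
  have htr := tradeOff_map (E := Fin n → Fin l → ℝ) (F := Matrix (Fin n) (Fin l) ℝ)
    (stdG n l) (Measure.map f (stdG n l)) (fun g => A * Matrix.of g)
    (fun g => Matrix.of.symm (A⁻¹ * g)) (measurable_mulMat A) (measurable_mulMat A⁻¹) (fun x => by
      rw [← Matrix.mul_assoc, Matrix.nonsing_inv_mul _ hAu, Matrix.one_mul]; rfl) α
  rw [hQmap, hSvA, gaussianMatrixCols_eq_map A hAu.ne_zero, htr]
  have hq : ∃ t, wchisqCDF n l (fun k => 1 - 1 / lam k) t = 1 - α := by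
    refine exists_quantile n l hl _ ?_ _ ⟨by linarith [hα.2], by linarith [hα.1]⟩
    obtain ⟨k, hk⟩ := hone
    refine ⟨k, fun h => hk ?_⟩
    have := (hlpos k).ne'
    field_simp at h
    linarith
  have ht := Function.invFun_eq hq
  change wchisqCDF n l (fun k => 1 - 1 / lam k)
    (wchisqQuantile n l (fun k => 1 - 1 / lam k) (1 - α)) = 1 - α at ht
  set t := wchisqQuantile n l (fun k => 1 - 1 / lam k) (1 - α) with htdef
  have hTm : ∀ c : Fin n → ℝ, Measurable (fun g : Fin n → Fin l → ℝ => ∑ k, c k * ∑ j, g k j ^ 2) :=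
    fun c => by fun_prop
  have hcdf : ∀ c : Fin n → ℝ, wchisqCDF n l c t =
      (stdG n l).real {g | ∑ k, c k * ∑ j, g k j ^ 2 ≤ t} := by
    intro c
    unfold wchisqCDF
    rw [Measure.map_apply (hTm c) measurableSet_Iic]
    rfl
  have hK : 0 < ∏ k, (Real.sqrt (lam k))⁻¹ ^ l :=
    Finset.prod_pos fun k _ => pow_pos (inv_pos.mpr (Real.sqrt_pos.mpr (hlpos k))) _
  set K := ∏ k, (Real.sqrt (lam k))⁻¹ ^ l with hKdef
  have hset : {g : Fin n → Fin l → ℝ | K * Real.exp (1/2 * ∑ k, (1 - 1 / lam k) * ∑ j, g k j ^ 2)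
      ≤ K * Real.exp (1/2 * t)} = {g | ∑ k, (1 - 1 / lam k) * ∑ j, g k j ^ 2 ≤ t} := by
    ext g
    simp only [mem_ofPred_eq]
    rw [mul_le_mul_iff_right₀ hK, Real.exp_le_exp]
    constructor <;> intro h <;> linarith
  have : IsProbabilityMeasure (Measure.map f (stdG n l)) :=
    Measure.isProbabilityMeasure_map hfm.aemeasurable
  rw [neyman_pearson (stdG n l) (Measure.map f (stdG n l))
    (fun g => K * Real.exp (1/2 * ∑ k, (1 - 1 / lam k) * ∑ j, g k j ^ 2)) (by fun_prop)
    (fun g => by positivity) (scale_density n l lam hlpos) (K * Real.exp (1/2 * t)) (by positivity) α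
    (by rw [hset, ← ht, hcdf]), hset, hcdf, measureReal_def,
    Measure.map_apply hfm (measurableSet_le (hTm _) measurable_const)]
  unfold Measure.real
  congr 2
  ext g
  simp only [mem_preimage, mem_ofPred_eq, hf]
  have : ∑ k, (1 - 1 / lam k) * ∑ j, (Real.sqrt (lam k) * g k j) ^ 2 =
      ∑ k, (lam k - 1) * ∑ j, g k j ^ 2 := by
    refine Finset.sum_congr rfl fun k _ => ?_
    have := (hlpos k).ne'
    simp_rw [mul_pow, Real.sq_sqrt (hlpos k).le]
    rw [← Finset.mul_sum, ← mul_assoc]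
    congr 1
    field_simp
  rw [this]

end Paper
end
end
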